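/- For every ε > 0 there exists an integer n_ε such that every multigraph G with n > n_ε vertices has pathwidth at most (1/6)·n₃ + (1/3)·n₄ + (13/30)·n₅ + (23/45)·n₆ + (359/630)·n₇ + (1553/2520)·n₈ + (14827/22680)·n₉ + (155273/226800)·n₁₀ + n_{≥11} + ε·n, where for i ∈ {3,…,10}, n_i denotes the number of vertices of G of degree exactly i, and n_{≥11} denotes the number of vertices of degree at least 11. -/

import Mathlib

/-!
A multigraph is given by a type `V` of vertices, a type `E` of edge indices, and a map
`ends : E → Sym2 V` giving the (unordered) pair of endpoints of each edge.
-/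

/-- The multiset of endpoints of an unordered pair (a loop contributes its vertex twice). -/
def Sym2.toMul {V : Type} : Sym2 V → Multiset V :=
  Sym2.lift ⟨fun a b => {a, b}, fun a b => Multiset.pair_comm a b⟩

/-- The degree of a vertex `v` in the multigraph with edges indexed by `E`
(loops count twice). -/
def Multigraph.deg {V E : Type} [Fintype E] [DecidableEq V]
    (ends : E → Sym2 V) (v : V) : ℕ :=
  ∑ e : E, Multiset.count v (ends e).toMul

/-- `X` is a path decomposition of the multigraph with endpoint map `ends`. -/
def Multigraph.IsPathDecomp {V E : Type} (ends : E → Sym2 V) (r : ℕ)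
    (X : Fin (r + 1) → Finset V) : Prop :=
  (∀ v : V, ∃ t, v ∈ X t) ∧
  (∀ (v : V) (a b c : Fin (r + 1)), a ≤ b → b ≤ c → v ∈ X a → v ∈ X c → v ∈ X b) ∧
  (∀ e : E, ∃ t, ∀ u, u ∈ ends e → u ∈ X t)

/-- The pathwidth of a multigraph. -/
noncomputable def Multigraph.pathwidth {V E : Type} (ends : E → Sym2 V) : ℕ :=
  sInf {w : ℕ | ∃ (r : ℕ) (X : Fin (r + 1) → Finset V),
    Multigraph.IsPathDecomp ends r X ∧ ∀ t, (X t).card ≤ w + 1}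

/-- The number of vertices of degree exactly `i`. -/
noncomputable def Multigraph.numDeg {V E : Type} [Fintype V] [DecidableEq V] [Fintype E]
    (ends : E → Sym2 V) (i : ℕ) : ℕ :=
  (Finset.univ.filter fun v : V => Multigraph.deg ends v = i).card

/-- The number of vertices of degree at least `i`. -/
noncomputable def Multigraph.numDegGE {V E : Type} [Fintype V] [DecidableEq V] [Fintype E]
    (ends : E → Sym2 V) (i : ℕ) : ℕ :=
  (Finset.univ.filter fun v : V => i ≤ Multigraph.deg ends v).card

namespace PathwidthBound

open scoped Classical

set_option linter.unusedSectionVars false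

variable {V : Type} [DecidableEq V]

/-- The number of neighbours of `x` in `S`. -/
noncomputable def nb (G : SimpleGraph V) (x : V) (S : Finset V) : ℕ :=
  (S.filter fun y => G.Adj x y).card

/-- The number of ordered pairs `(x, y) ∈ S × T` of adjacent vertices. -/
noncomputable def edg (G : SimpleGraph V) (S T : Finset V) : ℕ :=
  ∑ x ∈ S, nb G x T

section counting

variable (G : SimpleGraph V)

lemma nb_mono {x : V} {S T : Finset V} (h : ∀ y ∈ S, G.Adj x y → y ∈ T) :
    nb G x S ≤ nb G x T := by
  refine Finset.card_le_card fun y hy => ?_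
  simp only [Finset.mem_filter] at hy ⊢
  exact ⟨h y hy.1 hy.2, hy.2⟩

lemma nb_union {x : V} {S T : Finset V} (h : Disjoint S T) :
    nb G x (S ∪ T) = nb G x S + nb G x T := by
  unfold nb
  rw [Finset.filter_union, Finset.card_union_of_disjoint]
  exact Finset.disjoint_filter_filter h

lemma nb_sdiff {x : V} {S T : Finset V} (h : S ⊆ T) :
    nb G x S + nb G x (T \ S) = nb G x T := by
  rw [← nb_union G Finset.disjoint_sdiff, Finset.union_sdiff_of_subset h]

lemma nb_eq_zero {x : V} {S : Finset V} : nb G x S = 0 ↔ ∀ y ∈ S, ¬ G.Adj x y := by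
  simp [nb, Finset.card_eq_zero, Finset.filter_eq_empty_iff]

lemma nb_pos {x : V} {S : Finset V} : 0 < nb G x S ↔ ∃ y ∈ S, G.Adj x y := by
  rw [Nat.pos_iff_ne_zero, Ne, nb_eq_zero]
  push Not
  rfl

lemma edg_comm (S T : Finset V) : edg G S T = edg G T S := by
  unfold edg nb
  simp only [Finset.card_filter]
  rw [Finset.sum_comm]
  simp only [G.adj_comm]

lemma edg_union_left {S S' : Finset V} (T : Finset V) (h : Disjoint S S') :
    edg G (S ∪ S') T = edg G S T + edg G S' T := Finset.sum_union h

lemma edg_union_right (S : Finset V) {T T' : Finset V} (h : Disjoint T T') :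
    edg G S (T ∪ T') = edg G S T + edg G S T' := by
  simp only [edg, nb_union G h, Finset.sum_add_distrib]

lemma edg_sdiff_right (S : Finset V) {T T' : Finset V} (h : T ⊆ T') :
    edg G S T + edg G S (T' \ T) = edg G S T' := by
  rw [← edg_union_right G S Finset.disjoint_sdiff, Finset.union_sdiff_of_subset h]

lemma edg_sdiff_left {S S' : Finset V} (T : Finset V) (h : S ⊆ S') :
    edg G S T + edg G (S' \ S) T = edg G S' T := by
  rw [← edg_union_left G T Finset.disjoint_sdiff, Finset.union_sdiff_of_subset h]

lemma edg_pos {S T : Finset V} {x y : V} (hx : x ∈ S) (hy : y ∈ T) (h : G.Adj x y) :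
    0 < edg G S T :=
  lt_of_lt_of_le ((nb_pos G).2 ⟨y, hy, h⟩)
    (Finset.single_le_sum (f := fun x => nb G x T) (fun _ _ => Nat.zero_le _) hx)

lemma edg_const {S T : Finset V} {d : ℕ} (h : ∀ x ∈ S, nb G x T = d) :
    edg G S T = d * S.card := by
  rw [edg, Finset.sum_congr rfl h, Finset.sum_const, smul_eq_mul, mul_comm]

/-- The neighbourhood of `Y` in `P`. -/
noncomputable def nbhd (G : SimpleGraph V) (P Y : Finset V) : Finset V :=
  Y.biUnion fun y => P.filter fun x => G.Adj y x

lemma mem_nbhd {P Y : Finset V} {x : V} : x ∈ nbhd G P Y ↔ x ∈ P ∧ ∃ y ∈ Y, G.Adj y x := by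
  simp only [nbhd, Finset.mem_biUnion, Finset.mem_filter]
  tauto

lemma card_nbhd_le {P Y : Finset V} {d : ℕ} (h : ∀ y ∈ Y, nb G y P ≤ d) :
    (nbhd G P Y).card ≤ Y.card * d :=
  Finset.card_biUnion_le_card_mul _ _ _ h

end counting

section clusters

variable (G : SimpleGraph V)

/-- `S` spans at least `|S| - 1` edges. -/
def Spanning (S : Finset V) : Prop := 2 * S.card ≤ edg G S S + 2

lemma Spanning.union {S T : Finset V} (hS : Spanning G S) (hT : Spanning G T)
    (hST : Disjoint S T) {x y : V} (hx : x ∈ S) (hy : y ∈ T) (h : G.Adj x y) :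
    Spanning G (S ∪ T) := by
  have h1 : edg G (S ∪ T) (S ∪ T) = edg G S S + edg G S T + (edg G T S + edg G T T) := by
    rw [edg_union_left G _ hST, edg_union_right G _ hST, edg_union_right G _ hST]
  have h2 := edg_pos G hx hy h
  have h3 := edg_comm G S T
  have h4 := Finset.card_union_of_disjoint hST
  unfold Spanning at *
  omega

lemma exists_clusters (B : Finset V) (N : ℕ) (hN : 1 ≤ N) :
    ∃ f : V → V,
      (∀ a, (B.filter fun x => f x = a).card ≤ 2 * N) ∧
      (∀ a, Spanning G (B.filter fun x => f x = a)) ∧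
      (∀ x ∈ B, ∀ y ∈ B, G.Adj x y → f x ≠ f y →
        N < (B.filter fun z => f z = f x).card ∨ N < (B.filter fun z => f z = f y).card) := by
  let Good : (V → V) → Prop := fun f =>
    (∀ a, (B.filter fun x => f x = a).card ≤ 2 * N) ∧
      (∀ a, Spanning G (B.filter fun x => f x = a))
  have hid : Good id := by
    have hc : ∀ a, (B.filter fun x => id x = a).card ≤ 1 := by
      intro a
      rw [Finset.card_le_one]
      intro x hx y hy
      simp only [Finset.mem_filter, id] at hx hy
      rw [hx.2, hy.2]
    refine ⟨fun a => (hc a).trans (by omega), fun a => ?_⟩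
    have := hc a
    unfold Spanning
    omega
  obtain ⟨f, hf, hmin⟩ : ∃ f, Good f ∧ ∀ g, Good g → (B.image f).card ≤ (B.image g).card := by
    have := WellFounded.has_min (measure fun f : V → V => (B.image f).card).wf {f | Good f} ⟨id, hid⟩
    obtain ⟨f, hf, h⟩ := this
    exact ⟨f, hf, fun g hg => not_lt.1 (h g hg)⟩
  refine ⟨f, hf.1, hf.2, fun x hx y hy hxy hne => ?_⟩
  by_contra! hcon
  set g : V → V := fun z => if f z = f y then f x else f z with hg
  have hgx : (B.filter fun z => g z = f x) =
      (B.filter fun z => f z = f x) ∪ (B.filter fun z => f z = f y) := by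
    ext z
    simp only [hg, Finset.mem_filter, Finset.mem_union]
    by_cases h : f z = f y <;> simp +contextual [h]
  have hgy : (B.filter fun z => g z = f y) = ∅ := by
    ext z
    simp only [hg, Finset.mem_filter]
    by_cases h : f z = f y <;> simp [h, hne]
  have hga : ∀ a, a ≠ f x → a ≠ f y →
      (B.filter fun z => g z = a) = (B.filter fun z => f z = a) := by
    intro a hax hay
    ext z
    simp only [hg, Finset.mem_filter]
    by_cases h : f z = f y
    · simp [h, hax.symm, hay.symm]
    · simp [h]
  have hdis : Disjoint (B.filter fun z => f z = f x) (B.filter fun z => f z = f y) := by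
    rw [Finset.disjoint_filter]
    intro z _ h1 h2
    exact hne (h1.symm.trans h2)
  have hgood : Good g := by
    constructor
    · intro a
      by_cases hax : a = f x
      · rw [hax, hgx, Finset.card_union_of_disjoint hdis]
        omega
      by_cases hay : a = f y
      · rw [hay, hgy]; simp
      rw [hga a hax hay]
      exact hf.1 a
    · intro a
      by_cases hax : a = f x
      · rw [hax, hgx]
        exact (hf.2 _).union G (hf.2 _) hdis (by simp [hx]) (by simp [hy]) hxy
      by_cases hay : a = f y
      · rw [hay, hgy]; simp [Spanning]
      rw [hga a hax hay]
      exact hf.2 a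
  have hlt : (B.image g).card < (B.image f).card := by
    apply Finset.card_lt_card
    rw [Finset.ssubset_iff_of_subset]
    · refine ⟨f y, Finset.mem_image_of_mem f hy, fun h => ?_⟩
      obtain ⟨z, hz, h⟩ := Finset.mem_image.1 h
      have : z ∈ B.filter fun z => g z = f y := by simp [hz, h]
      rw [hgy] at this
      simp at this
    · intro a ha
      obtain ⟨z, hz, rfl⟩ := Finset.mem_image.1 ha
      simp only [hg]
      split_ifs
      · exact Finset.mem_image_of_mem f hx
      · exact Finset.mem_image_of_mem f hz
  exact absurd (hmin g hgood) (not_le.2 hlt)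

end clusters

section groups

variable (G : SimpleGraph V)

lemma Spanning.biUnion {S : Finset V} (hS : Spanning G S) {F : V → Finset V} {J : Finset V}
    (hF : ∀ b ∈ J, Spanning G (F b)) (hd : ∀ b ∈ J, Disjoint S (F b))
    (hdd : ∀ b ∈ J, ∀ c ∈ J, b ≠ c → Disjoint (F b) (F c))
    (hadj : ∀ b ∈ J, ∃ x ∈ S, ∃ y ∈ F b, G.Adj x y) :
    Spanning G (S ∪ J.biUnion F) := by
  induction J using Finset.induction_on with
  | empty => simpa using hS
  | insert b J hb ih =>
    have ih' := ih (fun c hc => hF c (Finset.mem_insert_of_mem hc))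
      (fun c hc => hd c (Finset.mem_insert_of_mem hc))
      (fun c hc e he => hdd c (Finset.mem_insert_of_mem hc) e (Finset.mem_insert_of_mem he))
      (fun c hc => hadj c (Finset.mem_insert_of_mem hc))
    have hbm := Finset.mem_insert_self b J
    obtain ⟨x, hx, y, hy, hxy⟩ := hadj b hbm
    rw [Finset.biUnion_insert, Finset.union_comm (F b), ← Finset.union_assoc]
    refine ih'.union G (hF b hbm) ?_ (Finset.mem_union_left _ hx) hy hxy
    rw [Finset.disjoint_union_left, Finset.disjoint_biUnion_left]
    refine ⟨hd b hbm, fun c hc => hdd c (Finset.mem_insert_of_mem hc) b hbm ?_⟩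
    rintro rfl
    exact hb hc

/-- A vertex set of maximum degree at most three splits into a part that is the disjoint union of
spanning pieces of bounded size, and a part with small components. -/
lemma exists_groups (B : Finset V) (N : ℕ) (hN : 1 ≤ N) (hB : ∀ x ∈ B, nb G x B ≤ 3) :
    ∃ (L I : Finset V) (g : V → V) (C : V → Finset V),
      L ⊆ B ∧ (∀ x ∈ L, g x ∈ I) ∧
      (∀ a ∈ I, N ≤ (L.filter fun x => g x = a).card) ∧
      (∀ a ∈ I, (L.filter fun x => g x = a).card ≤ 2 * N + 2 * N * 3 * (2 * N)) ∧
      (∀ a ∈ I, Spanning G (L.filter fun x => g x = a)) ∧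
      (∀ x ∈ L, ∀ y ∈ B, G.Adj x y → y ∈ L) ∧
      (∀ y ∈ B \ L, y ∈ C y ∧ C y ⊆ B \ L ∧ (C y).card ≤ 2 * N ∧
        ∀ z ∈ C y, ∀ w ∈ B, G.Adj z w → w ∈ C y) := by
  obtain ⟨f, hcard, hspan, hadj⟩ := exists_clusters G B N hN
  set F : V → Finset V := fun a => B.filter fun x => f x = a with hF
  have memF : ∀ {x a}, x ∈ F a ↔ x ∈ B ∧ f x = a := by intro x a; simp [hF]
  let near : V → V → Prop := fun a b => N < (F b).card ∧ ∃ x ∈ F b, ∃ y ∈ F a, G.Adj x y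
  let h : V → V := fun a => if N < (F a).card then a else
    if hb : ∃ b, near a b then hb.choose else a
  have h_large : ∀ a, N < (F a).card → h a = a := fun a ha => if_pos ha
  have h_near : ∀ a, ¬ N < (F a).card → (∃ b, near a b) → near a (h a) := by
    intro a ha hb
    simp only [h, if_neg ha, dif_pos hb]
    exact hb.choose_spec
  have h_spec : ∀ a, N < (F (h a)).card → h a = a ∨ near a (h a) := by
    intro a ha
    by_cases hl : N < (F a).card
    · exact Or.inl (h_large a hl)
    by_cases hb : ∃ b, near a b
    · exact Or.inr (h_near a hl hb)
    · simp only [h, if_neg hl, dif_neg hb, true_or]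
  let L := B.filter fun x => N < (F (h (f x))).card
  have memL : ∀ {x}, x ∈ L ↔ x ∈ B ∧ N < (F (h (f x))).card := by intro x; simp [L]
  let I := L.image fun x => h (f x)
  have hI : ∀ a ∈ I, N < (F a).card ∧ h a = a := by
    intro a ha
    obtain ⟨x, hx, rfl⟩ := Finset.mem_image.1 ha
    have := (memL.1 hx).2
    exact ⟨this, h_large _ this⟩
  have hsub : ∀ a ∈ I, F a ⊆ L.filter fun x => h (f x) = a := by
    intro a ha x hx
    obtain ⟨h1, h2⟩ := hI a ha
    obtain ⟨h3, h4⟩ := memF.1 hx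
    simp only [Finset.mem_filter, memL]
    rw [h4, h2]
    exact ⟨⟨h3, h1⟩, rfl⟩
  have hlab : ∀ a ∈ I, ∀ x ∈ L, h (f x) = a → f x = a ∨
      ∃ u ∈ F a, ∃ y ∈ F (f x), G.Adj u y := by
    intro a ha x hx hxa
    rcases h_spec (f x) (memL.1 hx).2 with h1 | h1
    · exact Or.inl (h1.symm.trans hxa)
    · rw [hxa] at h1
      exact Or.inr h1.2
  refine ⟨L, I, fun x => h (f x), fun y => F (f y), Finset.filter_subset _ _,
    fun x hx => Finset.mem_image_of_mem _ hx, fun a ha => ?_, fun a ha => ?_, fun a ha => ?_,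
    fun x hx y hy hxy => ?_, fun y hy => ?_⟩
  · exact (hI a ha).1.le.trans (Finset.card_le_card (hsub a ha))
  · have hcov : (L.filter fun x => h (f x) = a) ⊆
        F a ∪ (nbhd G B (F a)).biUnion fun y => F (f y) := by
      intro x hx
      obtain ⟨hx, hxa⟩ := Finset.mem_filter.1 hx
      have hxB := (memL.1 hx).1
      rw [Finset.mem_union, Finset.mem_biUnion]
      rcases hlab a ha x hx hxa with h1 | ⟨u, hu, y, hy, huy⟩
      · exact Or.inl (memF.2 ⟨hxB, h1⟩)
      · obtain ⟨hyB, hyx⟩ := memF.1 hy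
        exact Or.inr ⟨y, (mem_nbhd G).2 ⟨hyB, u, hu, huy⟩, memF.2 ⟨hxB, hyx.symm⟩⟩
    refine (Finset.card_le_card hcov).trans ((Finset.card_union_le _ _).trans ?_)
    refine Nat.add_le_add (hcard a) ?_
    refine (Finset.card_biUnion_le_card_mul _ _ (2 * N) fun y _ => hcard _).trans ?_
    refine Nat.mul_le_mul_right _ ?_
    refine (card_nbhd_le G (d := 3) fun y hy => hB y (memF.1 hy).1).trans ?_
    exact Nat.mul_le_mul_right _ (hcard a)
  · let J := ((L.filter fun x => h (f x) = a).image f).erase a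
    have hJ : ∀ b ∈ J, b ≠ a ∧ ∃ x ∈ L, h (f x) = a ∧ f x = b := by
      intro b hb
      obtain ⟨hb, x, hx, rfl⟩ : b ≠ a ∧ ∃ x ∈ L.filter fun x => h (f x) = a, f x = b := by
        simpa [J] using hb
      exact ⟨hb, x, (Finset.mem_filter.1 hx).1, (Finset.mem_filter.1 hx).2, rfl⟩
    have heq : (L.filter fun x => h (f x) = a) = F a ∪ J.biUnion F := by
      ext x
      constructor
      · intro hx
        by_cases hxa : f x = a
        · exact Finset.mem_union_left _
            (memF.2 ⟨(memL.1 (Finset.mem_filter.1 hx).1).1, hxa⟩)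
        · refine Finset.mem_union_right _ (Finset.mem_biUnion.2 ⟨f x, ?_, memF.2
            ⟨(memL.1 (Finset.mem_filter.1 hx).1).1, rfl⟩⟩)
          exact Finset.mem_erase.2 ⟨hxa, Finset.mem_image_of_mem _ hx⟩
      · intro hx
        rcases Finset.mem_union.1 hx with hx | hx
        · exact hsub a ha hx
        · obtain ⟨b, hb, hx⟩ := Finset.mem_biUnion.1 hx
          obtain ⟨-, z, hz, hza, rfl⟩ := hJ b hb
          obtain ⟨hxB, hxz⟩ := memF.1 hx
          rw [Finset.mem_filter, memL, hxz]
          exact ⟨⟨hxB, (memL.1 hz).2⟩, hza⟩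
    have hdisj : ∀ b c, b ≠ c → Disjoint (F b) (F c) := by
      intro b c hbc
      rw [Finset.disjoint_left]
      intro x hx hx'
      exact hbc ((memF.1 hx).2.symm.trans (memF.1 hx').2)
    rw [heq]
    refine (hspan a).biUnion G (fun b _ => hspan b) (fun b hb => hdisj _ _ (hJ b hb).1.symm)
      (fun b _ c _ hbc => hdisj _ _ hbc) fun b hb => ?_
    obtain ⟨hba, x, hx, hxa, rfl⟩ := hJ b hb
    exact (hlab a ha x hx hxa).resolve_left hba
  · have hxB := (memL.1 hx).1
    refine memL.2 ⟨hy, ?_⟩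
    by_cases hxy' : f x = f y
    · rw [← hxy']; exact (memL.1 hx).2
    by_cases hyl : N < (F (f y)).card
    · rw [h_large _ hyl]; exact hyl
    have hxl : N < (F (f x)).card := (hadj x hxB y hy hxy hxy').resolve_right hyl
    exact (h_near (f y) hyl ⟨f x, hxl, x, memF.2 ⟨hxB, rfl⟩, y, memF.2 ⟨hy, rfl⟩, hxy⟩).1
  · obtain ⟨hyB, hyL⟩ := Finset.mem_sdiff.1 hy
    refine ⟨memF.2 ⟨hyB, rfl⟩, fun z hz => ?_, hcard _, fun z hz w hw hzw => ?_⟩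
    · obtain ⟨hzB, hzy⟩ := memF.1 hz
      refine Finset.mem_sdiff.2 ⟨hzB, fun hzL => hyL ?_⟩
      have := (memL.1 hzL).2
      rw [hzy] at this
      exact memL.2 ⟨hyB, this⟩
    · obtain ⟨hzB, hzy⟩ := memF.1 hz
      by_contra hwy
      have hne : f z ≠ f w := fun h => hwy (memF.2 ⟨hw, h.symm.trans hzy⟩)
      have hyl : ¬ N < (F (f y)).card := by
        intro hl
        refine hyL (memL.2 ⟨hyB, ?_⟩)
        rw [h_large _ hl]; exact hl
      have hwl : N < (F (f w)).card := by
        rcases hadj z hzB w hw hzw hne with h1 | h1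
        · rw [hzy] at h1
          exact absurd h1 hyl
        · exact h1
      refine hyL (memL.2 ⟨hyB, ?_⟩)
      exact (h_near (f y) hyl ⟨f w, hwl, w, memF.2 ⟨hw, rfl⟩, z, hz, hzw.symm⟩).1

end groups

section improving

variable (G : SimpleGraph V)

lemma edg_mono_right {S T T' : Finset V} (h : T ⊆ T') : edg G S T ≤ edg G S T' :=
  Finset.sum_le_sum fun _ _ => nb_mono G fun _ hy _ => h hy

/-- If `S ∪ X`, completed by small components and by the vertices of `A` next to it, is not
improving, then `X` is small. -/
lemma card_le_of_not_improving {W P A B L S X : Finset V} {C : V → Finset V} {N K s : ℕ}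
    (hA : ∀ x ∈ A, nb G x (W \ P) = 1 ∧ nb G x P = 2)
    (hB : ∀ x ∈ B, nb G x (W \ P) = 0 ∧ nb G x P = 3)
    (hAB : P = A ∪ B) (hdAB : Disjoint A B)
    (hK : ∀ T ⊆ P, T.Nonempty → T.card ≤ K → edg G T (W \ P) ≤ edg G T (P \ T))
    (hLB : L ⊆ B) (hL : ∀ x ∈ L, ∀ y ∈ B, G.Adj x y → y ∈ L)
    (hC : ∀ y ∈ B \ L, y ∈ C y ∧ C y ⊆ B \ L ∧ (C y).card ≤ 2 * N ∧
        ∀ z ∈ C y, ∀ w ∈ B, G.Adj z w → w ∈ C y)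
    (hS : S ⊆ L) (hX : X ⊆ A) (hSX : ∀ x ∈ S, ∀ y ∈ A, G.Adj x y → y ∈ X)
    (hScard : S.card ≤ s) (hXcard : X.card ≤ 3 * s + 1)
    (hsK : s + (3 * s + 1) * (4 + 24 * N) ≤ K) :
    X.card ≤ edg G S (L \ S) + ∑ x ∈ X, nb G x (L \ S) := by
  set Y := (B \ L) ∩ nbhd G P X with hY
  set Cc := Y.biUnion C with hCc
  set R := (A ∩ (nbhd G P X ∪ nbhd G P Cc)) \ X with hR
  set T := S ∪ Cc ∪ X ∪ R with hT
  have hAP : A ⊆ P := hAB ▸ Finset.subset_union_left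
  have hBP : B ⊆ P := hAB ▸ Finset.subset_union_right
  have hCcB : Cc ⊆ B \ L := by
    intro z hz
    obtain ⟨y, hy, hz⟩ := Finset.mem_biUnion.1 hz
    exact (hC y (Finset.mem_inter.1 hy).1).2.1 hz
  have hCccl : ∀ z ∈ Cc, ∀ w ∈ B, G.Adj z w → w ∈ Cc := by
    intro z hz w hw hzw
    obtain ⟨y, hy, hz⟩ := Finset.mem_biUnion.1 hz
    exact Finset.mem_biUnion.2 ⟨y, hy, (hC y (Finset.mem_inter.1 hy).1).2.2.2 z hz w hw hzw⟩
  have hRA : R ⊆ A := fun z hz => (Finset.mem_inter.1 (Finset.mem_sdiff.1 hz).1).1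
  have hTP : T ⊆ P := by
    refine Finset.union_subset (Finset.union_subset (Finset.union_subset ?_ ?_) ?_) ?_
    · exact (hS.trans hLB).trans hBP
    · exact (hCcB.trans Finset.sdiff_subset).trans hBP
    · exact hX.trans hAP
    · exact hRA.trans hAP
  have hd1 : Disjoint S Cc := by
    rw [Finset.disjoint_left]
    exact fun z hz hz' => (Finset.mem_sdiff.1 (hCcB hz')).2 (hS hz)
  have hd2 : Disjoint (S ∪ Cc) X := by
    rw [Finset.disjoint_left]
    intro z hz hz'
    refine Finset.disjoint_left.1 hdAB (hX hz') ?_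
    rcases Finset.mem_union.1 hz with hz | hz
    · exact hLB (hS hz)
    · exact (Finset.mem_sdiff.1 (hCcB hz)).1
  have hd3 : Disjoint (S ∪ Cc ∪ X) R := by
    rw [Finset.disjoint_left]
    intro z hz hz'
    rcases Finset.mem_union.1 hz with hz | hz
    · refine Finset.disjoint_left.1 hdAB (hRA hz') ?_
      rcases Finset.mem_union.1 hz with hz | hz
      · exact hLB (hS hz)
      · exact (Finset.mem_sdiff.1 (hCcB hz)).1
    · exact (Finset.mem_sdiff.1 hz').2 hz
  rcases X.eq_empty_or_nonempty with rfl | hXne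
  · simp
  have hdeg : ∀ y ∈ P, nb G y P ≤ 3 := by
    intro y hy
    rw [hAB] at hy
    rcases Finset.mem_union.1 hy with hy | hy
    · rw [(hA y hy).2]; omega
    · rw [(hB y hy).2]
  have hcard : T.card ≤ K := by
    have h1 : (nbhd G P X).card ≤ X.card * 3 :=
      card_nbhd_le G fun y hy => hdeg y (hAP (hX hy))
    have h2 : Y.card ≤ X.card * 3 := (Finset.card_le_card Finset.inter_subset_right).trans h1
    have h3 : Cc.card ≤ Y.card * (2 * N) :=
      Finset.card_biUnion_le_card_mul _ _ _ fun y hy => (hC y (Finset.mem_inter.1 hy).1).2.2.1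
    have h4 : (nbhd G P Cc).card ≤ Cc.card * 3 :=
      card_nbhd_le G fun y hy => hdeg y (hBP (Finset.mem_sdiff.1 (hCcB hy)).1)
    have h5 : R.card ≤ (nbhd G P X).card + (nbhd G P Cc).card :=
      (Finset.card_le_card (Finset.sdiff_subset.trans Finset.inter_subset_right)).trans
        (Finset.card_union_le _ _)
    have h6 : T.card = S.card + Cc.card + X.card + R.card := by
      rw [hT, Finset.card_union_of_disjoint hd3, Finset.card_union_of_disjoint hd2,
        Finset.card_union_of_disjoint hd1]
    have h7 : Cc.card ≤ X.card * 3 * (2 * N) := h3.trans (Nat.mul_le_mul_right _ h2)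
    have h8 : X.card * (4 + 24 * N) ≤ (3 * s + 1) * (4 + 24 * N) := Nat.mul_le_mul_right _ hXcard
    have h9 : X.card * (4 + 24 * N) = 4 * X.card + 4 * (X.card * 3 * (2 * N)) := by ring
    omega
  have hTne : T.Nonempty := by
    obtain ⟨x, hx⟩ := hXne
    exact ⟨x, by simp [hT, hx]⟩
  have hXT : X ⊆ T := by
    intro z hz; simp [hT, hz]
  have hST : S ⊆ T := by
    intro z hz; simp [hT, hz]
  have hCT : Cc ⊆ T := by
    intro z hz; simp [hT, hz]
  have hA_near : ∀ z ∈ A, z ∈ nbhd G P X ∪ nbhd G P Cc → z ∈ T := by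
    intro z hz hz'
    by_cases hzX : z ∈ X
    · exact hXT hzX
    · exact Finset.mem_union_right _ (Finset.mem_sdiff.2 ⟨Finset.mem_inter.2 ⟨hz, hz'⟩, hzX⟩)
  have key := hK T hTP hTne hcard
  have eT : ∀ U, edg G T U = edg G S U + edg G Cc U + edg G X U + edg G R U := by
    intro U
    rw [hT, edg_union_left G _ hd3, edg_union_left G _ hd2, edg_union_left G _ hd1]
  have a1 : edg G S (P \ T) ≤ edg G S (L \ S) := by
    refine Finset.sum_le_sum fun x hx => nb_mono G fun y hy hxy => ?_
    obtain ⟨hyP, hyT⟩ := Finset.mem_sdiff.1 hy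
    have : y ∈ B := by
      rw [hAB] at hyP
      rcases Finset.mem_union.1 hyP with hy | hy
      · exact absurd (hXT (hSX x hx y hy hxy)) hyT
      · exact hy
    exact Finset.mem_sdiff.2 ⟨hL x (hS hx) y this hxy, fun h => hyT (hST h)⟩
  have a2 : edg G Cc (P \ T) = 0 := by
    refine Finset.sum_eq_zero fun x hx => (nb_eq_zero G).2 fun y hy hxy => ?_
    obtain ⟨hyP, hyT⟩ := Finset.mem_sdiff.1 hy
    have hyP' := hyP
    rw [hAB] at hyP
    rcases Finset.mem_union.1 hyP with hy | hy
    · exact hyT (hA_near y hy (Finset.mem_union_right _ ((mem_nbhd G).2 ⟨hyP', x, hx, hxy⟩)))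
    · exact hyT (hCT (hCccl x hx y hy hxy))
  have a3 : edg G X (P \ T) ≤ ∑ x ∈ X, nb G x (L \ S) := by
    refine Finset.sum_le_sum fun x hx => nb_mono G fun y hy hxy => ?_
    obtain ⟨hyP, hyT⟩ := Finset.mem_sdiff.1 hy
    have hyn : y ∈ nbhd G P X := (mem_nbhd G).2 ⟨hyP, x, hx, hxy⟩
    rw [hAB] at hyP
    rcases Finset.mem_union.1 hyP with hy | hy
    · exact absurd (hA_near y hy (Finset.mem_union_left _ hyn)) hyT
    · refine Finset.mem_sdiff.2 ⟨?_, fun h => hyT (hST h)⟩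
      by_contra hyL
      have hyY : y ∈ B \ L := Finset.mem_sdiff.2 ⟨hy, hyL⟩
      exact hyT (hCT (Finset.mem_biUnion.2 ⟨y, Finset.mem_inter.2 ⟨hyY, hyn⟩, (hC y hyY).1⟩))
  have a4 : edg G R (P \ T) ≤ R.card := by
    rw [Finset.card_eq_sum_ones]
    refine Finset.sum_le_sum fun x hx => ?_
    have h1 := (hA x (hRA hx)).2
    have h2 := nb_sdiff G (x := x) hTP
    have h3 : 0 < nb G x T := by
      rw [nb_pos]
      have := (Finset.mem_inter.1 (Finset.mem_sdiff.1 hx).1).2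
      rcases Finset.mem_union.1 this with h | h
      · obtain ⟨_, y, hy, hyx⟩ := (mem_nbhd G).1 h
        exact ⟨y, hXT hy, hyx.symm⟩
      · obtain ⟨_, y, hy, hyx⟩ := (mem_nbhd G).1 h
        exact ⟨y, hCT hy, hyx.symm⟩
    omega
  have b1 : edg G X (W \ P) = X.card := by
    rw [edg_const G (d := 1) fun x hx => (hA x (hX hx)).1, one_mul]
  have b2 : edg G R (W \ P) = R.card := by
    rw [edg_const G (d := 1) fun x hx => (hA x (hRA hx)).1, one_mul]
  have e1 := eT (W \ P)
  have e2 := eT (P \ T)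
  omega

/-- The size of the improving sets in `exists_improving`. -/
def improvingBound (N : ℕ) : ℕ :=
  2 * N + 2 * N * 3 * (2 * N) + (3 * (2 * N + 2 * N * 3 * (2 * N)) + 1) * (4 + 24 * N)

/-- In a part `P` of a cubic graph with many edges leaving it there is a set of bounded size whose
removal decreases the number of edges leaving `P`. -/
lemma exists_improving {N : ℕ} (hN : 1 ≤ N) {W P : Finset V}
    (hPW : P ⊆ W) (hdeg : ∀ x ∈ P, nb G x W = 3)
    (hlt : (N + 2) * P.card < 3 * N * edg G P (W \ P)) :
    ∃ S ⊆ P, S.Nonempty ∧ S.card ≤ improvingBound N ∧ edg G S (P \ S) < edg G S (W \ P) := by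
  unfold improvingBound
  set s := 2 * N + 2 * N * 3 * (2 * N) with hs
  set K := s + (3 * s + 1) * (4 + 24 * N) with hKdef
  have hK1 : 1 ≤ K := by
    have : 1 * 4 ≤ (3 * s + 1) * (4 + 24 * N) := Nat.mul_le_mul (by omega) (by omega)
    omega
  by_contra! hK
  have hle1 : ∀ x ∈ P, nb G x (W \ P) ≤ 1 := by
    intro x hx
    have h1 := hK {x} (by simpa using hx) (by simp) (by simpa using hK1)
    have h2 := nb_sdiff G (x := x) hPW
    have h3 : nb G x (P \ {x}) ≤ nb G x P := nb_mono G fun y hy _ => (Finset.mem_sdiff.1 hy).1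
    simp only [edg, Finset.sum_singleton] at h1
    have := hdeg x hx
    omega
  set A := P.filter fun x => nb G x (W \ P) = 1 with hAdef
  set B := P.filter fun x => ¬ nb G x (W \ P) = 1 with hBdef
  have hAB : P = A ∪ B := (Finset.filter_union_filter_not_eq _ _).symm
  have hdAB : Disjoint A B := Finset.disjoint_filter_filter_not _ _ _
  have hA : ∀ x ∈ A, nb G x (W \ P) = 1 ∧ nb G x P = 2 := by
    intro x hx
    obtain ⟨hx, h1⟩ := Finset.mem_filter.1 hx
    have h2 := nb_sdiff G (x := x) hPW
    have := hdeg x hx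
    omega
  have hB : ∀ x ∈ B, nb G x (W \ P) = 0 ∧ nb G x P = 3 := by
    intro x hx
    obtain ⟨hx, h1⟩ := Finset.mem_filter.1 hx
    have h2 := nb_sdiff G (x := x) hPW
    have h3 := hle1 x hx
    have := hdeg x hx
    omega
  have hAP : A ⊆ P := hAB ▸ Finset.subset_union_left
  have hBP : B ⊆ P := hAB ▸ Finset.subset_union_right
  obtain ⟨L, I, g, C, hLB, hgI, hbig, hsmall, hspan, hL, hC⟩ := exists_groups G B N hN
    (fun x hx => (nb_mono G fun y hy _ => hBP hy).trans (hB x hx).2.le)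
  set F : V → Finset V := fun a => L.filter fun x => g x = a with hF
  have hFL : ∀ a, F a ⊆ L := fun a => Finset.filter_subset _ _
  have hLP : L ⊆ P := hLB.trans hBP
  have hAL : ∀ x ∈ A, nb G x L ≤ 2 := fun x hx =>
    (nb_mono G fun y hy _ => hLP hy).trans (hA x hx).2.le
  have hL1 : ∀ x ∈ A, 1 ≤ nb G x L := by
    intro x hx
    have := card_le_of_not_improving G (S := ∅) (X := {x}) (s := s) (K := K) hA hB hAB hdAB hK
      hLB hL hC (by simp) (by simpa using hx) (by simp) (by simp) (by simp) le_rfl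
    simpa [edg] using this
  have hgroup : ∀ a ∈ I, ∑ x ∈ A, ((nb G x (F a) : ℤ) * (3 - nb G x L)) ≤ (F a).card + 2 := by
    intro a ha
    set X := A.filter fun x => 1 ≤ nb G x (F a) with hX
    have hFd : ∀ x ∈ F a, nb G x P ≤ 3 := fun x hx => (hB x (hLB (hFL a hx))).2.le
    have hXc : X.card ≤ 3 * s + 1 := by
      have : X ⊆ nbhd G P (F a) := by
        intro x hx
        obtain ⟨hx, h1⟩ := Finset.mem_filter.1 hx
        obtain ⟨y, hy, hxy⟩ := (nb_pos G).1 h1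
        exact (mem_nbhd G).2 ⟨hAP hx, y, hy, hxy.symm⟩
      have h1 := Finset.card_le_card this
      have h2 := card_nbhd_le G hFd
      have h3 := hsmall a ha
      simp only [← hs] at h3
      have : (F a).card ≤ s := h3
      omega
    have h1 := card_le_of_not_improving G (S := F a) (X := X) (s := s) (K := K) hA hB hAB hdAB hK
      hLB hL hC (hFL a) (Finset.filter_subset _ _) (fun x hx y hy hxy =>
        Finset.mem_filter.2 ⟨hy, (nb_pos G).2 ⟨x, hx, hxy.symm⟩⟩) (hsmall a ha) hXc le_rfl
    have h2 : edg G (F a) (F a) + edg G (F a) (L \ F a) + edg G (F a) A = 3 * (F a).card := by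
      rw [edg_sdiff_right G _ (hFL a)]
      rw [← edg_const G (d := 3) fun x hx => (hB x (hLB (hFL a hx))).2]
      rw [hAB, edg_union_right G _ hdAB, add_comm]
      congr 1
      exact le_antisymm (edg_mono_right G hLB) (Finset.sum_le_sum fun x hx =>
        nb_mono G fun y hy hxy => hL x (hFL a hx) y hy hxy)
    have h3 : 2 * (F a).card ≤ edg G (F a) (F a) + 2 := hspan a ha
    have h4 : edg G (F a) A = ∑ x ∈ A, nb G x (F a) := edg_comm G _ _
    have h5 : (∑ x ∈ X, ((1 : ℤ) - nb G x (L \ F a))) + ∑ x ∈ A, (nb G x (F a) : ℤ)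
        ≤ (F a).card + 2 := by
      rw [Finset.sum_sub_distrib]
      simp only [Finset.sum_const, nsmul_eq_mul, mul_one]
      have h1' : (X.card : ℤ) ≤ edg G (F a) (L \ F a) + ∑ x ∈ X, (nb G x (L \ F a) : ℤ) := by
        exact_mod_cast h1
      have h4' : (edg G (F a) A : ℤ) = ∑ x ∈ A, (nb G x (F a) : ℤ) := by exact_mod_cast h4
      rw [← h4']
      omega
    refine le_trans ?_ h5
    rw [show ∑ x ∈ X, ((1 : ℤ) - nb G x (L \ F a)) = _ from Finset.sum_filter _ _,
      ← Finset.sum_add_distrib]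
    refine Finset.sum_le_sum fun x hx => ?_
    have h6 := nb_sdiff G (x := x) (hFL a)
    have h7 := hL1 x hx
    have h8 := hAL x hx
    have h9 : nb G x L = 1 ∨ nb G x L = 2 := by omega
    rcases h9 with h9 | h9 <;> rw [h9] at h6 ⊢ <;> split_ifs <;> push_cast <;> omega
  have hsumF : ∀ x, ∑ a ∈ I, nb G x (F a) = nb G x L := by
    intro x
    unfold nb
    rw [Finset.card_eq_sum_card_fiberwise (f := g) (t := I)]
    · refine Finset.sum_congr rfl fun a _ => ?_
      congr 1
      ext y
      simp only [hF, Finset.mem_filter]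
      tauto
    · intro y hy
      exact hgI y (Finset.mem_filter.1 hy).1
  have hcardL : ∑ a ∈ I, (F a).card = L.card :=
    (Finset.card_eq_sum_card_fiberwise (f := g) (t := I) fun y hy => hgI y hy).symm
  have hsum : 2 * (A.card : ℤ) ≤ L.card + 2 * I.card := by
    have h1 := Finset.sum_le_sum hgroup
    rw [Finset.sum_comm, Finset.sum_add_distrib] at h1
    have h2 : ∑ x ∈ A, (2 : ℤ) ≤ ∑ x ∈ A, ∑ a ∈ I, (nb G x (F a) : ℤ) * (3 - nb G x L) := by
      refine Finset.sum_le_sum fun x hx => ?_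
      rw [← Finset.sum_mul]
      have h3 : ∑ a ∈ I, (nb G x (F a) : ℤ) = nb G x L := by exact_mod_cast hsumF x
      rw [h3]
      have h7 := hL1 x hx
      have h8 := hAL x hx
      have h9 : nb G x L = 1 ∨ nb G x L = 2 := by omega
      rcases h9 with h9 | h9 <;> rw [h9] <;> norm_num
    have h3 : ∑ a ∈ I, ((F a).card : ℤ) = L.card := by exact_mod_cast hcardL
    rw [h3] at h1
    simp only [Finset.sum_const, nsmul_eq_mul] at h1 h2
    linarith
  have hI : I.card * N ≤ L.card := by
    rw [← hcardL]
    exact Finset.card_nsmul_le_sum _ _ _ hbig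
  have hcA : edg G P (W \ P) = A.card := by
    rw [hAB, edg_union_left G _ hdAB, ← hAB, edg_const G fun x hx => (hA x hx).1,
      edg_const G fun x hx => (hB x hx).1]
    omega
  have hcP : P.card = A.card + B.card := by
    rw [← Finset.card_union_of_disjoint hdAB, ← hAB]
  have hLB' := Finset.card_le_card hLB
  have hsum' : 2 * A.card ≤ L.card + 2 * I.card := by exact_mod_cast hsum
  rw [hcA, hcP] at hlt
  have t1 := Nat.mul_le_mul_right N hsum'
  have t2 := Nat.mul_le_mul_right N hLB'
  nlinarith
end improving

section width

variable {G : SimpleGraph V}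

/-- The graph induced by `G` on `A` has an interval model (equivalently, a path decomposition) in
which at most `k` vertices are present at any time. -/
def HasWidth (G : SimpleGraph V) (A : Finset V) (k : ℕ) : Prop :=
  ∃ l r : V → ℕ, (∀ v ∈ A, l v ≤ r v) ∧ (∀ u ∈ A, ∀ v ∈ A, G.Adj u v → l u ≤ r v) ∧
    ∀ t, (A.filter fun v => l v ≤ t ∧ t ≤ r v).card ≤ k

lemma HasWidth.mono {A : Finset V} {k k' : ℕ} (h : HasWidth G A k) (hk : k ≤ k') :
    HasWidth G A k' := by
  obtain ⟨l, r, h1, h2, h3⟩ := h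
  exact ⟨l, r, h1, h2, fun t => (h3 t).trans hk⟩

lemma HasWidth.mono_graph {G' : SimpleGraph V} {A : Finset V} {k : ℕ} (h : HasWidth G' A k)
    (hG : ∀ u ∈ A, ∀ v ∈ A, G.Adj u v → G'.Adj u v) : HasWidth G A k := by
  obtain ⟨l, r, h1, h2, h3⟩ := h
  exact ⟨l, r, h1, fun u hu v hv huv => h2 u hu v hv (hG u hu v hv huv), h3⟩

lemma hasWidth_card (A : Finset V) : HasWidth G A A.card :=
  ⟨fun _ => 0, fun _ => 0, fun _ _ => le_rfl, fun _ _ _ _ _ => le_rfl,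
    fun _ => Finset.card_le_card (Finset.filter_subset _ _)⟩

lemma hasWidth_empty : HasWidth G ∅ 0 := hasWidth_card ∅

lemma HasWidth.of_erase {A : Finset V} {k : ℕ} {x : V} (h : HasWidth G (A.erase x) k) :
    HasWidth G A (k + 1) := by
  obtain ⟨l, r, h1, h2, h3⟩ := h
  refine ⟨fun v => if v = x then 0 else l v, fun v => if v = x then A.sup l else r v, ?_, ?_, ?_⟩
  · intro v hv
    by_cases h : v = x
    · simp [h]
    · simpa [h] using h1 v (Finset.mem_erase.2 ⟨h, hv⟩)
  · intro u hu v hv huv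
    by_cases h : u = x
    · simp [h]
    by_cases h' : v = x
    · simpa [h, h'] using Finset.le_sup (f := l) hu
    · simpa [h, h'] using h2 u (Finset.mem_erase.2 ⟨h, hu⟩) v (Finset.mem_erase.2 ⟨h', hv⟩) huv
  · intro t
    refine le_trans (Finset.card_le_card (t := insert x
      ((A.erase x).filter fun v => l v ≤ t ∧ t ≤ r v)) fun v hv => ?_)
      ((Finset.card_insert_le _ _).trans (Nat.succ_le_succ (h3 t)))
    obtain ⟨hv, h4⟩ := Finset.mem_filter.1 hv
    by_cases h : v = x
    · simp [h]
    · simp only [h, if_false] at h4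
      simp [h, hv, h4]

lemma HasWidth.of_sdiff {A S : Finset V} {k : ℕ} (h : HasWidth G (A \ S) k) :
    HasWidth G A (k + S.card) := by
  induction S using Finset.induction_on generalizing A with
  | empty => simpa using h
  | insert x S hx ih =>
    rw [Finset.card_insert_of_notMem hx, ← add_assoc]
    refine HasWidth.of_erase (x := x) (ih ?_)
    rwa [Finset.sdiff_insert, ← Finset.erase_sdiff_comm] at h

/-- Pieces attached to cliques of `W` can be inserted one at a time into an interval model
of `W`. -/
lemma HasWidth.insert_pieces {ι : Type} {A W : Finset V} {f : V → ι} {g : ι → Finset V}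
    {k j : ℕ} (hW : HasWidth G W k)
    (hf : ∀ x ∈ A \ W, ∀ y ∈ A \ W, G.Adj x y → f x = f y)
    (hgW : ∀ x ∈ A \ W, g (f x) ⊆ W)
    (hgc : ∀ x ∈ A \ W, ∀ u ∈ g (f x), ∀ v ∈ g (f x), u ≠ v → G.Adj u v)
    (hfg : ∀ x ∈ A \ W, ∀ y ∈ W, G.Adj x y → y ∈ g (f x))
    (hj : ∀ a, HasWidth G ((A \ W).filter fun x => f x = a) j) :
    HasWidth G A (k + j) := by
  obtain ⟨l, r, h1, h2, h3⟩ := hW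
  choose lp rp p1 p2 p3 using hj
  set J := (A \ W).image f with hJ
  set e : ι → ℕ := fun a => if h : a ∈ J then (J.equivFin ⟨a, h⟩ : ℕ) else 0 with he
  have he_lt : ∀ x ∈ A \ W, e (f x) < J.card := by
    intro x hx
    have : f x ∈ J := Finset.mem_image_of_mem f hx
    simp only [he, dif_pos this]
    exact Fin.is_lt _
  have he_inj : ∀ x ∈ A \ W, ∀ y ∈ A \ W, e (f x) = e (f y) → f x = f y := by
    intro x hx y hy hxy
    have h1 : f x ∈ J := Finset.mem_image_of_mem f hx
    have h2 : f y ∈ J := Finset.mem_image_of_mem f hy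
    simp only [he, dif_pos h1, dif_pos h2] at hxy
    have := J.equivFin.injective (Fin.ext hxy)
    simpa using this
  set M := (A.sup fun x => rp (f x) x) + 1 with hM
  have hrM : ∀ x ∈ A \ W, rp (f x) x < M := by
    intro x hx
    exact Nat.lt_succ_of_le (Finset.le_sup (f := fun x => rp (f x) x) (Finset.mem_sdiff.1 hx).1)
  have hlr : ∀ x ∈ A \ W, lp (f x) x ≤ rp (f x) x := fun x hx => p1 _ x (by simpa using hx)
  set t : ι → ℕ := fun a => (g a).sup l with ht
  have ht1 : ∀ x ∈ A \ W, ∀ u ∈ g (f x), l u ≤ t (f x) ∧ t (f x) ≤ r u := by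
    intro x hx u hu
    refine ⟨Finset.le_sup (f := l) hu, Finset.sup_le fun v hv => ?_⟩
    by_cases huv : v = u
    · rw [huv]
      exact h1 u (hgW x hx hu)
    · exact h2 v (hgW x hx hv) u (hgW x hx hu) (hgc x hx v hv u hu huv)
  set Z := J.card * M + 1 with hZ
  have hslot : ∀ x ∈ A \ W, ∀ s, s < M → e (f x) * M + s < Z := by
    intro x hx s hs
    have : (e (f x) + 1) * M ≤ J.card * M := Nat.mul_le_mul_right _ (he_lt x hx)
    rw [hZ]
    linarith [add_mul (e (f x)) 1 M]
  refine ⟨fun v => if v ∈ W then Z * l v else Z * t (f v) + (e (f v) * M + lp (f v) v),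
    fun v => if v ∈ W then Z * r v + (Z - 1) else Z * t (f v) + (e (f v) * M + rp (f v) v),
    ?_, ?_, ?_⟩
  · intro v hv
    by_cases hvW : v ∈ W
    · simp only [hvW, if_true]
      exact (Nat.mul_le_mul_left Z (h1 v hvW)).trans (Nat.le_add_right _ _)
    · simp only [hvW, if_false]
      have := hlr v (Finset.mem_sdiff.2 ⟨hv, hvW⟩)
      omega
  · intro u hu v hv huv
    by_cases huW : u ∈ W <;> by_cases hvW : v ∈ W <;> simp only [huW, hvW, if_true, if_false]
    · exact (Nat.mul_le_mul_left Z (h2 u huW v hvW huv)).trans (Nat.le_add_right _ _)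
    · have hv' := Finset.mem_sdiff.2 ⟨hv, hvW⟩
      have := ht1 v hv' u (hfg v hv' u huW huv.symm)
      exact (Nat.mul_le_mul_left Z this.1).trans (Nat.le_add_right _ _)
    · have hu' := Finset.mem_sdiff.2 ⟨hu, huW⟩
      have := ht1 u hu' v (hfg u hu' v hvW huv)
      have h4 := Nat.mul_le_mul_left Z this.2
      have h5 := hslot u hu' (lp (f u) u) ((hlr u hu').trans_lt (hrM u hu'))
      omega
    · have hu' := Finset.mem_sdiff.2 ⟨hu, huW⟩
      have hv' := Finset.mem_sdiff.2 ⟨hv, hvW⟩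
      have hfe := hf u hu' v hv' huv
      have := p2 (f u) u (by simpa using hu') v (by simpa [hfe] using hv') huv
      rw [hfe] at this ⊢
      omega
  · intro τ
    by_cases hne : ∃ x ∈ A \ W, Z * t (f x) + (e (f x) * M + lp (f x) x) ≤ τ ∧
        τ ≤ Z * t (f x) + (e (f x) * M + rp (f x) x)
    · have hdiv : ∀ x ∈ A \ W, Z * t (f x) + (e (f x) * M + lp (f x) x) ≤ τ →
          τ ≤ Z * t (f x) + (e (f x) * M + rp (f x) x) →
          τ % Z / M = e (f x) ∧ lp (f x) x ≤ τ % Z % M ∧ τ % Z % M ≤ rp (f x) x := by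
        intro x hx ha hb
        obtain ⟨s, rfl⟩ : ∃ s, τ = Z * t (f x) + (e (f x) * M + s) :=
          ⟨τ - (Z * t (f x) + e (f x) * M), by omega⟩
        have hs : s < M := by
          have := hrM x hx
          omega
        have e1 : (Z * t (f x) + (e (f x) * M + s)) % Z = e (f x) * M + s := by
          rw [Nat.mul_add_mod, Nat.mod_eq_of_lt (hslot x hx s hs)]
        have e2 : (e (f x) * M + s) / M = e (f x) := by
          rw [mul_comm, Nat.mul_add_div (by omega), Nat.div_eq_of_lt hs, add_zero]
        have e3 : (e (f x) * M + s) % M = s := by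
          rw [mul_comm, Nat.mul_add_mod, Nat.mod_eq_of_lt hs]
        rw [e1, e2, e3]
        omega
      obtain ⟨x, hx, hxa, hxb⟩ := hne
      refine le_trans (Finset.card_le_card (t := (W.filter fun v => l v ≤ τ / Z ∧ τ / Z ≤ r v) ∪
        (((A \ W).filter fun y => f y = f x).filter fun v => lp (f x) v ≤ τ % Z % M ∧
          τ % Z % M ≤ rp (f x) v)) fun v hv => ?_) ((Finset.card_union_le _ _).trans
          (add_le_add (h3 _) (p3 _ _)))
      obtain ⟨hv, ha, hb⟩ := Finset.mem_filter.1 hv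
      have hZ0 : 0 < Z := Nat.succ_pos _
      by_cases hvW : v ∈ W
      · simp only [hvW, if_true] at ha hb
        refine Finset.mem_union_left _ (Finset.mem_filter.2 ⟨hvW, ?_, ?_⟩)
        · rw [Nat.le_div_iff_mul_le hZ0, mul_comm]; exact ha
        · rw [← Nat.lt_succ_iff, Nat.div_lt_iff_lt_mul hZ0, Nat.succ_mul, mul_comm]
          omega
      · simp only [hvW, if_false] at ha hb
        have hv' := Finset.mem_sdiff.2 ⟨hv, hvW⟩
        have d1 := hdiv v hv' ha hb
        have d2 := hdiv x hx hxa hxb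
        have hfe := he_inj v hv' x hx (d1.1.symm.trans d2.1)
        rw [hfe] at d1
        refine Finset.mem_union_right _ (Finset.mem_filter.2 ⟨Finset.mem_filter.2 ⟨hv', hfe⟩, ?_⟩)
        exact d1.2
    · refine le_trans (Finset.card_le_card (t := (W.filter fun v => l v ≤ τ / Z ∧ τ / Z ≤ r v))
        fun v hv => ?_) ((h3 _).trans (Nat.le_add_right _ _))
      obtain ⟨hv, ha, hb⟩ := Finset.mem_filter.1 hv
      have hZ0 : 0 < Z := Nat.succ_pos _
      by_cases hvW : v ∈ W
      · simp only [hvW, if_true] at ha hb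
        refine Finset.mem_filter.2 ⟨hvW, ?_, ?_⟩
        · rw [Nat.le_div_iff_mul_le hZ0, mul_comm]; exact ha
        · rw [← Nat.lt_succ_iff, Nat.div_lt_iff_lt_mul hZ0, Nat.succ_mul, mul_comm]
          omega
      · simp only [hvW, if_false] at ha hb
        exact absurd ⟨v, Finset.mem_sdiff.2 ⟨hv, hvW⟩, ha, hb⟩ hne

end width

section cubic

variable {G : SimpleGraph V}

lemma HasWidth.of_labels {ι : Type} {A : Finset V} (f : V → ι) {k : ℕ}
    (hf : ∀ x ∈ A, ∀ y ∈ A, G.Adj x y → f x = f y)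
    (hk : ∀ a, HasWidth G (A.filter fun x => f x = a) k) : HasWidth G A k := by
  have := HasWidth.insert_pieces (G := G) (A := A) (W := ∅) (f := f) (g := fun _ => ∅) (k := 0)
    (j := k) hasWidth_empty (by simpa using hf) (by simp) (by simp) (by simp) (by simpa using hk)
  simpa using this

lemma HasWidth.union {A B : Finset V} {k : ℕ} (hA : HasWidth G A k) (hB : HasWidth G B k)
    (hd : Disjoint A B) (hAB : ∀ x ∈ A, ∀ y ∈ B, ¬ G.Adj x y) : HasWidth G (A ∪ B) k := by
  have hBA : ∀ x ∈ B, x ∉ A := fun x hx hx' => Finset.disjoint_left.1 hd hx' hx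
  refine HasWidth.of_labels (ι := Bool) (fun x => decide (x ∈ A)) (fun x hx y hy hxy => ?_)
    fun a => ?_
  · rcases Finset.mem_union.1 hx with hx | hx <;> rcases Finset.mem_union.1 hy with hy | hy
    · simp [hx, hy]
    · exact absurd hxy (hAB x hx y hy)
    · exact absurd hxy.symm (hAB y hy x hx)
    · simp [hBA x hx, hBA y hy]
  · cases a
    · convert hB using 1
      ext x
      have := hBA x
      simp only [Finset.mem_filter, Finset.mem_union, decide_eq_false_iff_not]
      tauto
    · convert hA using 1
      ext x
      simp only [Finset.mem_filter, Finset.mem_union, decide_eq_true_eq]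
      tauto

/-- `P` and `Q` are consecutive sets of a sweep of `W` in which at most `b` edges cross. -/
def Step (G : SimpleGraph V) (W : Finset V) (b : ℕ) (P Q : Finset V) : Prop :=
  ∃ x ∈ W, x ∉ P ∧ Q = insert x P ∧ edg G P (W \ P) ≤ b ∧ edg G Q (W \ Q) ≤ b

lemma edg_compl_comm {W P : Finset V} (h : P ⊆ W) :
    edg G (W \ P) (W \ (W \ P)) = edg G P (W \ P) := by
  rw [Finset.sdiff_sdiff_eq_self h, edg_comm]

lemma Step.compl {W P Q : Finset V} {b : ℕ} (hP : P ⊆ W) (h : Step G W b P Q) :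
    Step G W b (W \ Q) (W \ P) := by
  obtain ⟨x, hx, hxP, rfl, h1, h2⟩ := h
  have hQ : insert x P ⊆ W := Finset.insert_subset hx hP
  refine ⟨x, hx, by simp, ?_, by rwa [edg_compl_comm hQ], by rwa [edg_compl_comm hP]⟩
  ext y
  by_cases h : y = x <;> simp [h, hx, hxP]

lemma Step.subset {W P Q : Finset V} {b : ℕ} (h : Step G W b P Q) (hP : P ⊆ W) : Q ⊆ W := by
  obtain ⟨x, hx, hxP, rfl, -, -⟩ := h
  exact Finset.insert_subset hx hP

lemma sweep_compl {W P Q : Finset V} {b : ℕ} (hP : P ⊆ W)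
    (h : Relation.ReflTransGen (Step G W b) P Q) :
    Q ⊆ W ∧ Relation.ReflTransGen (Step G W b) (W \ Q) (W \ P) := by
  induction h with
  | refl => exact ⟨hP, .refl⟩
  | tail _ h ih => exact ⟨h.subset ih.1, .head (h.compl ih.1) ih.2⟩

lemma hasWidth_of_sweep {W : Finset V} {b : ℕ}
    (h : Relation.ReflTransGen (Step G W b) ∅ W) : HasWidth G W (b + 1) := by
  have key : ∀ P, Relation.ReflTransGen (Step G W b) ∅ P → P ⊆ W ∧ ∃ (l r : V → ℕ) (T : ℕ),
      (∀ v ∈ P, l v ≤ r v ∧ r v ≤ T) ∧ (∀ u ∈ P, ∀ v ∈ P, G.Adj u v → l u ≤ r v) ∧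
      (∀ v ∈ P, 0 < nb G v (W \ P) → r v = T) ∧
      ∀ t, (P.filter fun v => l v ≤ t ∧ t ≤ r v).card ≤ b + 1 := by
    intro P hP
    induction hP with
    | refl => exact ⟨by simp, fun _ => 0, fun _ => 0, 0, by simp⟩
    | @tail P Q _ h ih =>
      obtain ⟨hPW, l, r, T, h1, h2, h3, h4⟩ := ih
      refine ⟨h.subset hPW, ?_⟩
      obtain ⟨x, hx, hxP, rfl, hb, -⟩ := h
      have hne : ∀ v ∈ P, v ≠ x := fun v hv h => hxP (h ▸ hv)
      refine ⟨fun v => if v = x then T + 1 else l v,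
        fun v => if v = x ∨ 0 < nb G v (W \ P) then T + 1 else r v, T + 1, ?_, ?_, ?_, ?_⟩
      · intro v hv
        by_cases hvx : v = x
        · simp [hvx]
        · have hvP : v ∈ P := (Finset.mem_insert.1 hv).resolve_left hvx
          have := h1 v hvP
          simp only [hvx, if_false, false_or]
          split_ifs <;> omega
      · intro u hu v hv huv
        by_cases hvx : v = x
        · subst hvx
          simp only [true_or, if_true]
          by_cases hux : u = v
          · simp [hux]
          · have := h1 u ((Finset.mem_insert.1 hu).resolve_left hux)
            simp only [hux, if_false]
            omega
        · have hvP : v ∈ P := (Finset.mem_insert.1 hv).resolve_left hvx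
          by_cases hux : u = x
          · have : 0 < nb G v (W \ P) :=
              (nb_pos G).2 ⟨u, Finset.mem_sdiff.2 ⟨hux ▸ hx, hux ▸ hxP⟩, huv.symm⟩
            simp [hux, this]
          · have huP : u ∈ P := (Finset.mem_insert.1 hu).resolve_left hux
            have h5 := h2 u huP v hvP huv
            have h6 := h1 v hvP
            simp only [hux, hvx, if_false, false_or]
            split_ifs <;> omega
      · intro v hv hpos
        by_cases hvx : v = x
        · simp [hvx]
        · have : 0 < nb G v (W \ P) := hpos.trans_le (nb_mono G fun y hy _ => by
            simp only [Finset.mem_sdiff, Finset.mem_insert, not_or] at hy ⊢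
            exact ⟨hy.1, hy.2.2⟩)
          simp [this]
      · intro t
        by_cases ht : t ≤ T
        · refine le_trans (Finset.card_le_card fun v hv => ?_) (h4 t)
          obtain ⟨hv, ha, hb⟩ := Finset.mem_filter.1 hv
          by_cases hvx : v = x
          · simp only [hvx, if_true] at ha
            omega
          · have hvP : v ∈ P := (Finset.mem_insert.1 hv).resolve_left hvx
            simp only [hvx, if_false, false_or] at ha hb
            refine Finset.mem_filter.2 ⟨hvP, ha, ?_⟩
            split_ifs at hb with h
            · rw [h3 v hvP h]
              exact ht
            · exact hb
        · refine le_trans (Finset.card_le_card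
            (t := insert x (P.filter fun v => 0 < nb G v (W \ P))) fun v hv => ?_)
            ((Finset.card_insert_le _ _).trans (Nat.succ_le_succ (le_trans ?_ hb)))
          · obtain ⟨hv, ha, hb⟩ := Finset.mem_filter.1 hv
            by_cases hvx : v = x
            · simp [hvx]
            · have hvP : v ∈ P := (Finset.mem_insert.1 hv).resolve_left hvx
              simp only [hvx, false_or] at hb
              split_ifs at hb with h
              · simp [hvP, h]
              · have := h1 v hvP
                omega
          · rw [Finset.card_filter]
            refine Finset.sum_le_sum fun v _ => ?_
            split_ifs <;> omega
  obtain ⟨-, l, r, T, h1, h2, -, h4⟩ := key W h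
  exact ⟨l, r, fun v hv => (h1 v hv).1, h2, h4⟩

/-- Removing `S` from `P` changes the number of edges between `P` and its complement. -/
lemma edg_sdiff_cut {W P S : Finset V} (hP : P ⊆ W) (hS : S ⊆ P) :
    edg G (P \ S) (W \ (P \ S)) + edg G S (W \ P) = edg G P (W \ P) + edg G S (P \ S) := by
  have h1 : W \ (P \ S) = (W \ P) ∪ S := by
    ext y
    have h1 := @hP y
    have h2 := @hS y
    simp only [Finset.mem_sdiff, Finset.mem_union]
    tauto
  have hd : Disjoint (W \ P) S := by
    rw [Finset.disjoint_left]
    exact fun y hy hy' => (Finset.mem_sdiff.1 hy).2 (hS hy')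
  have h2 := edg_sdiff_left G (W \ P) hS
  rw [h1, edg_union_right G _ hd, edg_comm G (P \ S) S]
  omega

lemma edg_erase_cut_le {W P : Finset V} {x : V} (hP : P ⊆ W) (hx : x ∈ P)
    (hd : nb G x W ≤ 3) :
    edg G (P.erase x) (W \ P.erase x) ≤ edg G P (W \ P) + 3 := by
  have h1 := edg_sdiff_cut (G := G) (S := {x}) hP (by simpa using hx)
  rw [Finset.sdiff_singleton_eq_erase] at h1
  have h2 : edg G {x} (P.erase x) ≤ 3 := by
    simp only [edg, Finset.sum_singleton]
    exact (nb_mono G fun y hy _ => hP (Finset.mem_of_mem_erase hy)).trans hd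
  omega

lemma sweep_sdiff {W P S : Finset V} {b c : ℕ} (hP : P ⊆ W) (hS : S ⊆ P)
    (hd : ∀ x ∈ W, nb G x W ≤ 3) (hc : edg G P (W \ P) ≤ c) (hb : c + 3 * S.card ≤ b) :
    Relation.ReflTransGen (Step G W b) (P \ S) P := by
  induction S using Finset.induction_on generalizing P c with
  | empty => simpa using Relation.ReflTransGen.refl
  | insert x S hx ih =>
    rw [Finset.card_insert_of_notMem hx] at hb
    have hxP : x ∈ P := hS (Finset.mem_insert_self _ _)
    have h1 := edg_erase_cut_le hP hxP (hd x (hP hxP))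
    have h2 := ih (P := P.erase x) (c := c + 3) ((Finset.erase_subset _ _).trans hP)
      (fun y hy => Finset.mem_erase.2 ⟨fun h => hx (h ▸ hy), hS (Finset.mem_insert_of_mem hy)⟩)
      (by omega) (by omega)
    rw [Finset.sdiff_insert, ← Finset.erase_sdiff_comm]
    exact h2.tail ⟨x, hP hxP, by simp, (Finset.insert_erase hxP).symm, by omega, by omega⟩

lemma sweep_of_cut_le {N : ℕ} (hN : 1 ≤ N) {W P : Finset V} {c : ℕ} (hP : P ⊆ W)
    (hd : ∀ x ∈ W, nb G x W = 3) (hc : edg G P (W \ P) ≤ c + 3)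
    (hcard : (N + 2) * P.card ≤ 3 * N * c) :
    Relation.ReflTransGen (Step G W (c + 6 + 3 * improvingBound N)) ∅ P := by
  induction hn : P.card using Nat.strong_induction_on generalizing P with
  | _ n ih =>
    subst hn
    rcases P.eq_empty_or_nonempty with rfl | ⟨x, hx⟩
    · exact .refl
    by_cases hlt : (N + 2) * P.card < 3 * N * edg G P (W \ P)
    · obtain ⟨S, hSP, hSne, hSK, hS⟩ := exists_improving G hN hP (fun x hx => hd x (hP hx)) hlt
      have h1 := edg_sdiff_cut (G := G) hP hSP
      have h2 : (P \ S).card < P.card := Finset.card_lt_card (Finset.sdiff_ssubset hSP hSne)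
      refine (ih _ h2 (P := P \ S) (Finset.sdiff_subset.trans hP) (by omega) ?_ rfl).trans
        (sweep_sdiff hP hSP (fun x hx => (hd x hx).le) hc (by omega))
      exact (Nat.mul_le_mul_left _ h2.le).trans hcard
    · have h1 : 3 * N * edg G P (W \ P) ≤ 3 * N * c := (not_lt.1 hlt).trans hcard
      have h2 : edg G P (W \ P) ≤ c := Nat.le_of_mul_le_mul_left h1 (by omega)
      have h3 := edg_erase_cut_le hP hx (hd x (hP hx)).le
      have h4 : (P.erase x).card < P.card := Finset.card_erase_lt_of_mem hx
      refine (ih _ h4 (P := P.erase x) ((Finset.erase_subset _ _).trans hP) (by omega)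
        ((Nat.mul_le_mul_left _ h4.le).trans hcard) rfl).tail
        ⟨x, hP hx, by simp, (Finset.insert_erase hx).symm, by omega, by omega⟩

lemma improvingBound_pos (N : ℕ) : 1 ≤ improvingBound N := by
  have : 1 * 4 ≤ (3 * (2 * N + 2 * N * 3 * (2 * N)) + 1) * (4 + 24 * N) :=
    Nat.mul_le_mul (by omega) (by omega)
  unfold improvingBound
  omega

/-- A graph that is cubic on `W` has a balanced bisection of `W` cut by few edges. -/
lemma exists_bisection {N : ℕ} (hN : 1 ≤ N) {W : Finset V} (hd : ∀ x ∈ W, nb G x W = 3) {c : ℕ}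
    (hc : (N + 2) * (W.card + 2 * improvingBound N) ≤ 6 * N * c) :
    ∃ P ⊆ W, 2 * P.card ≤ W.card + 2 * improvingBound N ∧
      2 * (W \ P).card ≤ W.card + 2 * improvingBound N ∧ edg G P (W \ P) ≤ c := by
  set K := improvingBound N with hK
  have hK1 : 1 ≤ K := improvingBound_pos N
  set F := W.powerset.filter fun P => 2 * P.card ≤ W.card + 2 * K ∧
    2 * (W \ P).card ≤ W.card + 2 * K with hF
  have memF : ∀ {P}, P ∈ F ↔ P ⊆ W ∧ 2 * P.card ≤ W.card + 2 * K ∧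
      2 * (W \ P).card ≤ W.card + 2 * K := by
    intro P
    simp [hF]
  have hne : F.Nonempty := by
    obtain ⟨P, hP, hPc⟩ := Finset.exists_subset_card_eq (show W.card / 2 ≤ W.card by omega)
    have := Finset.card_sdiff_add_card_eq_card hP
    exact ⟨P, memF.2 ⟨hP, by omega, by omega⟩⟩
  obtain ⟨P, hP, hmin⟩ := F.exists_min_image (fun P => edg G P (W \ P)) hne
  have hcompl : ∀ P ∈ F, W \ P ∈ F := by
    intro P hP
    obtain ⟨h1, h2, h3⟩ := memF.1 hP
    exact memF.2 ⟨Finset.sdiff_subset, h3, by rwa [Finset.sdiff_sdiff_eq_self h1]⟩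
  have key : ∀ P ∈ F, (∀ Q ∈ F, edg G P (W \ P) ≤ edg G Q (W \ Q)) → (W \ P).card ≤ P.card →
      edg G P (W \ P) ≤ c := by
    intro P hP hmin hle
    obtain ⟨h1, h2, h3⟩ := memF.1 hP
    by_cases hlt : (N + 2) * P.card < 3 * N * edg G P (W \ P)
    · obtain ⟨S, hSP, hSne, hSK, hS⟩ := exists_improving G hN h1 (fun x hx => hd x (h1 hx)) hlt
      have e1 := edg_sdiff_cut (G := G) h1 hSP
      have e2 := Finset.card_sdiff_add_card_eq_card hSP
      have e3 := Finset.card_sdiff_add_card_eq_card h1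
      have hsub : P \ S ⊆ W := Finset.sdiff_subset.trans h1
      have e4 := Finset.card_sdiff_add_card_eq_card hsub
      have := hmin (P \ S) (memF.2 ⟨hsub, by omega, by omega⟩)
      omega
    · have e1 : (N + 2) * (2 * P.card) ≤ (N + 2) * (W.card + 2 * K) := Nat.mul_le_mul_left _ h2
      have e2 : 6 * N * edg G P (W \ P) ≤ 6 * N * c := by nlinarith
      exact Nat.le_of_mul_le_mul_left e2 (by omega)
  obtain ⟨h1, h2, h3⟩ := memF.1 hP
  refine ⟨P, h1, h2, h3, ?_⟩
  rcases le_total (W \ P).card P.card with hle | hle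
  · exact key P hP hmin hle
  · rw [← edg_compl_comm h1]
    refine key (W \ P) (hcompl P hP) (fun Q hQ => ?_) ?_
    · rw [edg_compl_comm h1]
      exact hmin Q hQ
    · rwa [Finset.sdiff_sdiff_eq_self h1]

lemma hasWidth_cubic {N : ℕ} (hN : 1 ≤ N) {W : Finset V} (hd : ∀ x ∈ W, nb G x W = 3) {c : ℕ}
    (hc : (N + 2) * (W.card + 2 * improvingBound N) ≤ 6 * N * c) :
    HasWidth G W (c + 6 + 3 * improvingBound N + 1) := by
  obtain ⟨P, hP, h1, h2, h3⟩ := exists_bisection hN hd hc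
  have s1 := sweep_of_cut_le hN (c := c) hP hd (by omega) (by nlinarith)
  have s2 := sweep_of_cut_le hN (P := W \ P) (c := c) Finset.sdiff_subset hd
    (by rw [edg_compl_comm hP]; omega) (by nlinarith)
  have s3 := (sweep_compl (Finset.empty_subset W) s2).2
  rw [Finset.sdiff_sdiff_eq_self hP, Finset.sdiff_empty] at s3
  exact hasWidth_of_sweep (s1.trans s3)

end cubic

section extension

variable {K : SimpleGraph V}

/-- `Ext K W A` says that `A` arises from `W` by successively adding vertices whose neighbourhood
among the earlier vertices is a clique with at most two vertices. -/
inductive Ext (K : SimpleGraph V) (W : Finset V) : Finset V → Prop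
  | base : Ext K W W
  | step {A : Finset V} {x : V} (h : Ext K W A) (hx : x ∉ A)
      (hc : ∀ u ∈ A, ∀ v ∈ A, K.Adj x u → K.Adj x v → u ≠ v → K.Adj u v)
      (hn : nb K x A ≤ 2) : Ext K W (insert x A)

lemma Ext.subset {W A : Finset V} (h : Ext K W A) : W ⊆ A := by
  induction h with
  | base => exact subset_rfl
  | step _ _ _ _ ih => exact ih.trans (Finset.subset_insert _ _)

lemma Ext.trans {W W' A : Finset V} (h' : Ext K W W') (h : Ext K W' A) : Ext K W A := by
  induction h with
  | base => exact h'
  | step _ hx hc hn ih => exact ih.step hx hc hn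

lemma Ext.inter {W A : Finset V} (h : Ext K W A) (B : Finset V) : Ext K (W ∩ B) (A ∩ B) := by
  induction h with
  | base => exact .base
  | @step A x _ hx hc hn ih =>
    by_cases hB : x ∈ B
    · rw [Finset.insert_inter_of_mem hB]
      refine ih.step (fun h => hx (Finset.mem_inter.1 h).1) (fun u hu v hv => hc u
        (Finset.mem_inter.1 hu).1 v (Finset.mem_inter.1 hv).1) ?_
      exact (nb_mono K fun y hy _ => (Finset.mem_inter.1 hy).1).trans hn
    · rwa [Finset.insert_inter_of_notMem hB]

lemma Ext.erase {W A : Finset V} (h : Ext K W A) (x : V) : Ext K (W.erase x) (A.erase x) := by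
  have h1 : ∀ B, B ⊆ A → B.erase x = B ∩ A.erase x := by
    intro B hB
    ext y
    have := @hB y
    simp only [Finset.mem_erase, Finset.mem_inter]
    tauto
  have := h.inter (A.erase x)
  rwa [← h1 W h.subset, ← h1 A subset_rfl] at this

/-- Adding to `K` the edges that make the neighbours of `x` in `W` pairwise adjacent. -/
def fill (K : SimpleGraph V) (W : Finset V) (x : V) : SimpleGraph V where
  Adj u v := K.Adj u v ∨ (u ≠ v ∧ (u ∈ W ∧ K.Adj x u) ∧ (v ∈ W ∧ K.Adj x v))
  symm := ⟨fun u v h => by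
    rcases h with h | ⟨h1, h2, h3⟩
    · exact Or.inl h.symm
    · exact Or.inr ⟨h1.symm, h3, h2⟩⟩
  loopless := ⟨fun u h => by
    rcases h with h | ⟨h1, -, -⟩
    · exact K.irrefl h
    · exact h1 rfl⟩

lemma Ext.fill {W A : Finset V} {x : V} (h : Ext K W A) (hx : x ∈ W) (hn : nb K x W ≤ 2) :
    Ext (fill K W x) (W.erase x) A := by
  have hadj : ∀ y, y = x ∨ y ∉ W → ∀ u, (PathwidthBound.fill K W x).Adj y u → K.Adj y u := by
    intro y hy u h
    rcases h with h | ⟨-, h, -⟩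
    · exact h
    · rcases hy with rfl | hy
      · exact absurd h.2 (K.irrefl)
      · exact absurd h.1 hy
  induction h with
  | base =>
    have : Ext (PathwidthBound.fill K W x) (W.erase x) (insert x (W.erase x)) := by
      refine Ext.base.step (by simp) (fun u hu v hv hxu hxv huv => ?_) ?_
      · exact Or.inr ⟨huv, ⟨Finset.mem_of_mem_erase hu, hadj x (Or.inl rfl) u hxu⟩,
          Finset.mem_of_mem_erase hv, hadj x (Or.inl rfl) v hxv⟩
      · refine le_trans (Finset.card_le_card fun y hy => ?_) hn
        obtain ⟨hy, hxy⟩ := Finset.mem_filter.1 hy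
        exact Finset.mem_filter.2 ⟨Finset.mem_of_mem_erase hy, hadj x (Or.inl rfl) y hxy⟩
    rwa [Finset.insert_erase hx] at this
  | @step A y h hy hc hn ih =>
    have hyW : y ∉ W := fun h' => hy (h.subset h')
    refine ih.step hy (fun u hu v hv hu' hv' huv => Or.inl ?_) ?_
    · exact hc u hu v hv (hadj y (Or.inr hyW) u hu') (hadj y (Or.inr hyW) v hv') huv
    · refine le_trans (Finset.card_le_card fun z hz => ?_) hn
      obtain ⟨hz, hyz⟩ := Finset.mem_filter.1 hz
      exact Finset.mem_filter.2 ⟨hz, hadj y (Or.inr hyW) z hyz⟩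

lemma nb_fill_le {W : Finset V} {x u : V} (hx : x ∈ W) (hn : nb K x W ≤ 2) (hu : u ∈ W) :
    nb (fill K W x) u (W.erase x) ≤ nb K u W := by
  by_cases hxu : K.Adj x u
  · have h1 : (W.erase x).filter (fun y => (fill K W x).Adj u y) ⊆
        ((W.filter fun y => K.Adj u y).erase x) ∪ ((W.filter fun y => K.Adj x y).erase u) := by
      intro y hy
      obtain ⟨hy, huy⟩ := Finset.mem_filter.1 hy
      obtain ⟨hyx, hy⟩ := Finset.mem_erase.1 hy
      rcases huy with h | ⟨h1, h2, h3⟩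
      · simp [hyx, hy, h]
      · simp [h1.symm, hy, h3.2]
    have h2 := (Finset.card_le_card h1).trans (Finset.card_union_le _ _)
    rw [Finset.card_erase_of_mem (by simp [hx, hxu.symm]),
      Finset.card_erase_of_mem (by simp [hu, hxu])] at h2
    have h3 : 0 < nb K u W := (nb_pos K).2 ⟨x, hx, hxu.symm⟩
    unfold nb at *
    omega
  · refine Finset.card_le_card fun y hy => ?_
    obtain ⟨hy, huy⟩ := Finset.mem_filter.1 hy
    refine Finset.mem_filter.2 ⟨Finset.mem_of_mem_erase hy, ?_⟩
    rcases huy with h | ⟨-, h, -⟩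
    · exact h
    · exact absurd h.2 hxu

lemma Ext.split {W A W₁ W₂ : Finset V} (h : Ext K W A) (hW : W = W₁ ∪ W₂) (hd : Disjoint W₁ W₂)
    (hno : ∀ x ∈ W₁, ∀ y ∈ W₂, ¬ K.Adj x y) :
    ∃ A₁ A₂, A = A₁ ∪ A₂ ∧ Disjoint A₁ A₂ ∧ (∀ x ∈ A₁, ∀ y ∈ A₂, ¬ K.Adj x y) ∧
      Ext K W₁ A₁ ∧ Ext K W₂ A₂ := by
  induction h with
  | base => exact ⟨W₁, W₂, hW, hd, hno, .base, .base⟩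
  | @step A x h hx hc hn ih =>
    obtain ⟨A₁, A₂, rfl, hd', hno', h1, h2⟩ := ih
    rw [Finset.mem_union, not_or] at hx
    by_cases hn1 : ∃ u ∈ A₁, K.Adj x u
    · obtain ⟨u, hu, hxu⟩ := hn1
      refine ⟨insert x A₁, A₂, (Finset.insert_union _ _ _).symm,
        Finset.disjoint_insert_left.2 ⟨hx.2, hd'⟩, ?_, h1.step hx.1 ?_ ?_, h2⟩
      · intro y hy z hz hyz
        rcases Finset.mem_insert.1 hy with rfl | hy
        · refine hno' u hu z hz (hc u (by simp [hu]) z (by simp [hz]) hxu hyz ?_)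
          rintro rfl
          exact Finset.disjoint_left.1 hd' hu hz
        · exact hno' y hy z hz hyz
      · exact fun u hu v hv => hc u (Finset.mem_union_left _ hu) v (Finset.mem_union_left _ hv)
      · exact (nb_mono K fun y hy _ => Finset.mem_union_left _ hy).trans hn
    · push Not at hn1
      refine ⟨A₁, insert x A₂, (Finset.union_insert _ _ _).symm,
        Finset.disjoint_insert_right.2 ⟨hx.1, hd'⟩, ?_, h1, h2.step hx.2 ?_ ?_⟩
      · intro y hy z hz hyz
        rcases Finset.mem_insert.1 hz with rfl | hz
        · exact hn1 y hy hyz.symm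
        · exact hno' y hy z hz hyz
      · exact fun u hu v hv => hc u (Finset.mem_union_right _ hu) v (Finset.mem_union_right _ hv)
      · exact (nb_mono K fun y hy _ => Finset.mem_union_right _ hy).trans hn

/-- The vertices added to `W` split into pieces, each attached to a clique with at most two
vertices. -/
lemma Ext.exists_labels {W A : Finset V} (h : Ext K W A) :
    ∃ (f : V → V) (g : V → Finset V), (∀ x ∈ A \ W, f x ∈ A) ∧
      (∀ x ∈ A \ W, ∀ y ∈ A \ W, K.Adj x y → f x = f y) ∧
      (∀ x ∈ A \ W, g (f x) ⊆ W) ∧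
      (∀ x ∈ A \ W, ∀ u ∈ g (f x), ∀ v ∈ g (f x), u ≠ v → K.Adj u v) ∧
      (∀ x ∈ A \ W, (g (f x)).card ≤ 2) ∧
      (∀ x ∈ A \ W, ∀ y ∈ W, K.Adj x y → y ∈ g (f x)) := by
  induction h with
  | base => exact ⟨id, fun _ => ∅, by simp, by simp, by simp, by simp, by simp, by simp⟩
  | @step A x h hx hc hn ih =>
    obtain ⟨f, g, f1, f2, g1, g2, g3, g4⟩ := ih
    have hxW : x ∉ W := fun h' => hx (h.subset h')
    have hmem : ∀ {y}, y ∈ insert x A \ W → y ≠ x → y ∈ A \ W := by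
      intro y hy hyx
      obtain ⟨hy, hyW⟩ := Finset.mem_sdiff.1 hy
      exact Finset.mem_sdiff.2 ⟨(Finset.mem_insert.1 hy).resolve_left hyx, hyW⟩
    by_cases hnb : ∃ z ∈ A \ W, K.Adj x z
    · obtain ⟨z, hz, hxz⟩ := hnb
      set f' : V → V := fun y => if y = x then f z else f y with hf'
      have hrep : ∀ y ∈ insert x A \ W, ∃ y' ∈ A \ W, f' y = f y' := by
        intro y hy
        by_cases hyx : y = x
        · exact ⟨z, hz, by simp [hf', hyx]⟩
        · exact ⟨y, hmem hy hyx, by simp [hf', hyx]⟩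
      have hxy : ∀ y ∈ A \ W, K.Adj x y → f z = f y := by
        intro y hy hxy
        by_cases hyz : z = y
        · rw [hyz]
        · exact f2 z hz y hy (hc z (Finset.mem_sdiff.1 hz).1 y (Finset.mem_sdiff.1 hy).1 hxz hxy hyz)
      refine ⟨f', g, ?_, ?_, ?_, ?_, ?_, ?_⟩
      · intro y hy
        obtain ⟨y', hy', e⟩ := hrep y hy
        rw [e]
        exact Finset.mem_insert_of_mem (f1 y' hy')
      · intro y hy w hw hyw
        by_cases hyx : y = x <;> by_cases hwx : w = x
        · rw [hyx, hwx]
        · simp only [hf', hyx, hwx, if_true, if_false]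
          exact hxy w (hmem hw hwx) (hyx ▸ hyw)
        · simp only [hf', hyx, hwx, if_true, if_false]
          exact (hxy y (hmem hy hyx) (hwx ▸ hyw).symm).symm
        · simp only [hf', hyx, hwx, if_false]
          exact f2 y (hmem hy hyx) w (hmem hw hwx) hyw
      · intro y hy
        obtain ⟨y', hy', e⟩ := hrep y hy
        rw [e]
        exact g1 y' hy'
      · intro y hy
        obtain ⟨y', hy', e⟩ := hrep y hy
        rw [e]
        exact g2 y' hy'
      · intro y hy
        obtain ⟨y', hy', e⟩ := hrep y hy
        rw [e]
        exact g3 y' hy'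
      · intro y hy w hw hyw
        by_cases hyx : y = x
        · subst hyx
          simp only [hf', if_true]
          refine g4 z hz w hw (hc z (Finset.mem_sdiff.1 hz).1 w (h.subset hw) hxz hyw ?_)
          rintro rfl
          exact (Finset.mem_sdiff.1 hz).2 hw
        · simp only [hf', hyx, if_false]
          exact g4 y (hmem hy hyx) w hw hyw
    · push Not at hnb
      have hfx : ∀ y ∈ A \ W, f y ≠ x := fun y hy e => hx (e ▸ f1 y hy)
      set f' : V → V := fun y => if y = x then x else f y with hf'
      set g' : V → Finset V := fun a => if a = x then A.filter fun y => K.Adj x y else g a with hg'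
      have hcase : ∀ y ∈ insert x A \ W, (y = x ∧ g' (f' y) = A.filter fun y => K.Adj x y) ∨
          (y ∈ A \ W ∧ g' (f' y) = g (f y)) := by
        intro y hy
        by_cases hyx : y = x
        · exact Or.inl ⟨hyx, by simp [hf', hg', hyx]⟩
        · exact Or.inr ⟨hmem hy hyx, by simp [hf', hg', hyx, hfx y (hmem hy hyx)]⟩
      refine ⟨f', g', ?_, ?_, ?_, ?_, ?_, ?_⟩
      · intro y hy
        by_cases hyx : y = x
        · simp [hf', hyx]
        · simp [hf', hyx, f1 y (hmem hy hyx)]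
      · intro y hy w hw hyw
        by_cases hyx : y = x <;> by_cases hwx : w = x
        · rw [hyx, hwx]
        · exact absurd (hyx ▸ hyw) (hnb w (hmem hw hwx))
        · exact absurd (hwx ▸ hyw).symm (hnb y (hmem hy hyx))
        · simp only [hf', hyx, hwx, if_false]
          exact f2 y (hmem hy hyx) w (hmem hw hwx) hyw
      · intro y hy
        rcases hcase y hy with ⟨-, e⟩ | ⟨hy', e⟩ <;> rw [e]
        · intro u hu
          obtain ⟨hu, hxu⟩ := Finset.mem_filter.1 hu
          by_contra huW
          exact hnb u (Finset.mem_sdiff.2 ⟨hu, huW⟩) hxu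
        · exact g1 y hy'
      · intro y hy
        rcases hcase y hy with ⟨-, e⟩ | ⟨hy', e⟩ <;> rw [e]
        · intro u hu v hv
          obtain ⟨hu, hxu⟩ := Finset.mem_filter.1 hu
          obtain ⟨hv, hxv⟩ := Finset.mem_filter.1 hv
          exact hc u hu v hv hxu hxv
        · exact g2 y hy'
      · intro y hy
        rcases hcase y hy with ⟨-, e⟩ | ⟨hy', e⟩ <;> rw [e]
        · exact hn
        · exact g3 y hy'
      · intro y hy w hw hyw
        rcases hcase y hy with ⟨rfl, e⟩ | ⟨hy', e⟩ <;> rw [e]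
        · exact Finset.mem_filter.2 ⟨h.subset hw, hyw⟩
        · exact g4 y hy' w hw hyw

/-- A graph built from the empty graph has balanced separators with at most three vertices. -/
lemma Ext.exists_separator {A : Finset V} (hA : Ext K ∅ A) :
    ∃ (S : Finset V) (f : V → Option V), S.card ≤ 3 ∧
      (∀ x ∈ A \ S, ∀ y ∈ A \ S, K.Adj x y → f x = f y) ∧
      ∀ a, 2 * ((A \ S).filter fun x => f x = a).card ≤ A.card := by
  have key : ∀ W, Ext K ∅ W → Ext K W A →
      (∃ f : V → V, (∀ x ∈ A \ W, ∀ y ∈ A \ W, K.Adj x y → f x = f y) ∧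
        ∀ a, 2 * ((A \ W).filter fun x => f x = a).card ≤ A.card) →
      ∃ (S : Finset V) (f : V → Option V), S.card ≤ 3 ∧
        (∀ x ∈ A \ S, ∀ y ∈ A \ S, K.Adj x y → f x = f y) ∧
        ∀ a, 2 * ((A \ S).filter fun x => f x = a).card ≤ A.card := by
    intro W hW
    induction hW with
    | base =>
      rintro - ⟨f, h1, h2⟩
      refine ⟨∅, fun x => some (f x), by simp, fun x hx y hy hxy =>
        congrArg some (h1 x hx y hy hxy), ?_⟩
      rintro (_ | a)
      · simp
      · simpa using h2 a
    | @step W x h hx hc hn ih =>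
      rintro hext ⟨f, h1, h2⟩
      have hext' : Ext K W A := (Ext.base.step hx hc hn).trans hext
      obtain ⟨f', g, -, f2, g1, -, g3, g4⟩ := hext'.exists_labels
      by_cases hsmall : ∀ a, 2 * ((A \ W).filter fun x => f' x = a).card ≤ A.card
      · exact ih hext' ⟨f', f2, hsmall⟩
      · push Not at hsmall
        obtain ⟨a, ha⟩ := hsmall
        set Q := (A \ W).filter fun x => f' x = a with hQ
        obtain ⟨q, hq⟩ : Q.Nonempty := by
          rw [Finset.nonempty_iff_ne_empty]
          intro h
          rw [h] at ha
          simp at ha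
        obtain ⟨hqA, rfl⟩ := Finset.mem_filter.1 hq
        have hQA : Q ⊆ A := (Finset.filter_subset _ _).trans Finset.sdiff_subset
        have hcl : ∀ y ∈ Q, ∀ z ∈ A, z ∉ insert x (g (f' q)) → K.Adj y z → z ∈ Q := by
          intro y hy z hz hzS hyz
          obtain ⟨hyA, hy⟩ := Finset.mem_filter.1 hy
          by_cases hzW : z ∈ W
          · exact absurd (Finset.mem_insert_of_mem (hy ▸ g4 y hyA z hzW hyz)) hzS
          · have hzA := Finset.mem_sdiff.2 ⟨hz, hzW⟩
            exact Finset.mem_filter.2 ⟨hzA, (f2 y hyA z hzA hyz) ▸ hy⟩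
        have hQx : ∀ y ∈ Q, y ∉ insert x (g (f' q)) → y ∈ A \ insert x W := by
          intro y hy hyS
          obtain ⟨hyA, -⟩ := Finset.mem_filter.1 hy
          simp only [Finset.mem_sdiff, Finset.mem_insert, not_or] at hyA hyS ⊢
          exact ⟨hyA.1, hyS.1, hyA.2⟩
        refine ⟨insert x (g (f' q)), fun y => if y ∈ Q then some (f y) else none,
          (Finset.card_insert_le _ _).trans (Nat.succ_le_succ (g3 q hqA)), ?_, ?_⟩
        · intro y hy z hz hyz
          obtain ⟨hyA, hyS⟩ := Finset.mem_sdiff.1 hy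
          obtain ⟨hzA, hzS⟩ := Finset.mem_sdiff.1 hz
          by_cases hyQ : y ∈ Q
          · have hzQ := hcl y hyQ z hzA hzS hyz
            simp only [hyQ, hzQ, if_true]
            rw [h1 y (hQx y hyQ hyS) z (hQx z hzQ hzS) hyz]
          · have hzQ : z ∉ Q := fun h => hyQ (hcl z h y hyA hyS hyz.symm)
            simp only [hyQ, hzQ, if_false]
        · rintro (_ | b)
          · have e1 := Finset.card_sdiff_add_card_eq_card hQA
            have e2 : ((A \ insert x (g (f' q))).filter fun y =>
                (if y ∈ Q then some (f y) else none) = none).card ≤ (A \ Q).card := by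
              refine Finset.card_le_card fun y hy => ?_
              obtain ⟨hy, h⟩ := Finset.mem_filter.1 hy
              refine Finset.mem_sdiff.2 ⟨(Finset.mem_sdiff.1 hy).1, fun hyQ => ?_⟩
              simp [hyQ] at h
            simp only at *
            omega
          · refine le_trans (Nat.mul_le_mul_left 2 (Finset.card_le_card fun y hy => ?_)) (h2 b)
            obtain ⟨hy, h⟩ := Finset.mem_filter.1 hy
            by_cases hyQ : y ∈ Q
            · simp only [hyQ, if_true, Option.some.injEq] at h
              exact Finset.mem_filter.2 ⟨hQx y hyQ (Finset.mem_sdiff.1 hy).2, h⟩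
            · simp [hyQ] at h
  exact key A hA .base ⟨id, by simp, by simp⟩

lemma Ext.hasWidth_log {A : Finset V} (hA : Ext K ∅ A) :
    HasWidth K A (3 * (Nat.log 2 A.card + 1)) := by
  induction hn : A.card using Nat.strong_induction_on generalizing A with
  | _ n ih =>
    subst hn
    by_cases h2 : A.card < 2
    · exact (hasWidth_card A).mono (by omega)
    push Not at h2
    obtain ⟨S, f, hS, h3, h4⟩ := hA.exists_separator
    refine HasWidth.mono (HasWidth.of_sdiff (S := S) (k := 3 * Nat.log 2 A.card)
      (HasWidth.of_labels f h3 fun a => ?_)) (by omega)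
    set Q := (A \ S).filter fun x => f x = a with hQ
    have hQA : Q ⊆ A := (Finset.filter_subset _ _).trans Finset.sdiff_subset
    have hext : Ext K ∅ Q := by
      have := hA.inter Q
      rwa [Finset.empty_inter, Finset.inter_eq_right.2 hQA] at this
    have hc : 2 * Q.card ≤ A.card := by convert h4 a
    suffices HasWidth K Q (3 * Nat.log 2 A.card) by convert this
    refine (ih Q.card (by omega) hext rfl).mono ?_
    rw [Nat.log_of_one_lt_of_le one_lt_two h2]
    have : Nat.log 2 Q.card ≤ Nat.log 2 (A.card / 2) := Nat.log_mono_right (by omega)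
    omega

lemma Ext.hasWidth {W A : Finset V} {k : ℕ} (h : Ext K W A) (hW : HasWidth K W k) :
    HasWidth K A (k + 3 * (Nat.log 2 A.card + 1)) := by
  obtain ⟨f, g, -, f2, g1, g2, -, g4⟩ := h.exists_labels
  refine hW.insert_pieces f2 g1 g2 g4 fun a => ?_
  set Q := (A \ W).filter fun x => f x = a with hQ
  have hQAW : Q ⊆ A \ W := Finset.filter_subset _ _
  have hQA : Q ⊆ A := hQAW.trans Finset.sdiff_subset
  have hext : Ext K ∅ Q := by
    have := h.inter Q
    rwa [Finset.inter_eq_right.2 hQA, Finset.disjoint_iff_inter_eq_empty.1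
      (Finset.disjoint_sdiff.mono_right hQAW)] at this
  suffices HasWidth K Q (3 * (Nat.log 2 A.card + 1)) by convert this
  refine hext.hasWidth_log.mono ?_
  have : Nat.log 2 Q.card ≤ Nat.log 2 A.card := Nat.log_mono_right (Finset.card_le_card hQA)
  omega

end extension

section weights

/-- The contribution of a vertex of degree `d` to the bound. -/
noncomputable def beta : ℕ → ℝ
  | 0 => 0
  | 1 => 0
  | 2 => 0
  | 3 => 1 / 6
  | 4 => 1 / 3
  | 5 => 13 / 30
  | 6 => 23 / 45
  | 7 => 359 / 630
  | 8 => 1553 / 2520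
  | 9 => 14827 / 22680
  | 10 => 155273 / 226800
  | _ => 1

/-- The decrease of `beta` when a vertex of degree `d` loses an edge. -/
noncomputable def delta (d : ℕ) : ℝ := beta d - beta (d - 1)

/-- The additional cost of a `d`-regular graph. -/
noncomputable def theta (d : ℕ) : ℝ := if d = 3 then 0 else delta (d - 1) - delta d

lemma beta_le_succ (d : ℕ) : beta d ≤ beta (d + 1) := by
  by_cases h : d < 11
  · interval_cases d <;> norm_num [beta]
  · obtain ⟨m, rfl⟩ : ∃ m, d = m + 11 := ⟨d - 11, by omega⟩
    simp [beta]

lemma beta_mono : Monotone beta := monotone_nat_of_le_succ beta_le_succ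

lemma beta_nonneg (d : ℕ) : 0 ≤ beta d := by
  simpa [beta] using beta_mono (Nat.zero_le d)

lemma beta_eq_zero {d : ℕ} (h : d ≤ 2) : beta d = 0 := by
  interval_cases d <;> simp [beta]

lemma le_beta {d : ℕ} (h : 3 ≤ d) : 1 / 6 ≤ beta d := by
  simpa [beta] using beta_mono h

lemma delta_anti {m d : ℕ} (hm : 3 ≤ m) (hmd : m ≤ d) (hd : d ≤ 10) : delta d ≤ delta m := by
  interval_cases d <;> interval_cases m <;> norm_num [delta, beta]

lemma theta_nonneg {d : ℕ} (h3 : 3 ≤ d) (h : d ≤ 10) : 0 ≤ theta d := by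
  interval_cases d <;> norm_num [theta, delta, beta]

lemma theta_le {d : ℕ} (h3 : 3 ≤ d) (h : d ≤ 10) : theta d ≤ 1 / 6 := by
  interval_cases d <;> norm_num [theta, delta, beta]

lemma gain_of_deficient {d : ℕ} (h4 : 4 ≤ d) (h : d ≤ 10) :
    beta d + ((d - 1 : ℕ) * delta d + delta (d - 1)) = 1 := by
  interval_cases d <;> norm_num [delta, beta]

lemma gain_of_regular {d : ℕ} (h4 : 4 ≤ d) (h : d ≤ 10) :
    beta d + d * delta d + theta d = 1 := by
  interval_cases d <;> norm_num [theta, delta, beta]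

lemma gain_of_cubic_nbrs {d : ℕ} (h4 : 4 ≤ d) (h : d ≤ 10) :
    1 + theta d ≤ beta d + d * delta 3 := by
  interval_cases d <;> norm_num [theta, delta, beta]

end weights

section levels

variable {K : SimpleGraph V}

/-- The total weight of `W`. -/
noncomputable def weight (K : SimpleGraph V) (W : Finset V) : ℝ := ∑ x ∈ W, beta (nb K x W)

/-- The additional cost at level `d`. -/
noncomputable def slack (K : SimpleGraph V) (W : Finset V) (d : ℕ) : ℝ :=
  if ∃ x ∈ W, 3 ≤ nb K x W ∧ nb K x W < d then 0 else theta d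

lemma slack_nonneg {W : Finset V} {d : ℕ} (h3 : 3 ≤ d) (h : d ≤ 10) : 0 ≤ slack K W d := by
  unfold slack
  split_ifs
  exacts [le_rfl, theta_nonneg h3 h]

lemma slack_le {W : Finset V} {d : ℕ} (h3 : 3 ≤ d) (h : d ≤ 10) : slack K W d ≤ theta d := by
  unfold slack
  split_ifs
  exacts [theta_nonneg h3 h, le_rfl]

/-- The bound on the width of all graphs on at most `n` vertices with core of maximum degree `d`. -/
def LevelBound (V : Type) [DecidableEq V] (n : ℕ) (ε D : ℝ) (d : ℕ) : Prop :=
  ∀ (K : SimpleGraph V) (A W : Finset V), Ext K W A → A.card ≤ n → (∀ x ∈ W, nb K x W ≤ d) →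
    ∃ k : ℕ, HasWidth K A k ∧ (k : ℝ) ≤ weight K W + slack K W d + ε * W.card + D

lemma nb_erase_of_adj {W : Finset V} {v y : V} (hv : v ∈ W) (h : K.Adj v y) :
    nb K y (W.erase v) + 1 = nb K y W := by
  have h1 := nb_sdiff K (x := y) (Finset.erase_subset v W)
  have h2 : nb K y (W \ W.erase v) = 1 := by
    have : W \ W.erase v = {v} := by
      ext z
      simp only [Finset.mem_sdiff, Finset.mem_erase, Finset.mem_singleton]
      constructor
      · tauto
      · rintro rfl
        simp [hv]
    rw [this]
    simp [nb, Finset.filter_singleton, h.symm]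
  omega

lemma nb_erase_of_not_adj {W : Finset V} {v y : V} (h : ¬ K.Adj v y) :
    nb K y (W.erase v) = nb K y W := by
  refine le_antisymm (nb_mono K fun z hz _ => Finset.mem_of_mem_erase hz)
    (nb_mono K fun z hz hyz => Finset.mem_erase.2 ⟨?_, hz⟩)
  rintro rfl
  exact h hyz.symm

lemma weight_erase {W : Finset V} {v : V} (hv : v ∈ W) :
    weight K (W.erase v) + (beta (nb K v W) + ∑ y ∈ W with K.Adj v y, delta (nb K y W)) =
      weight K W := by
  have h1 : ∑ y ∈ W with K.Adj v y, delta (nb K y W) =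
      ∑ y ∈ W.erase v, if K.Adj v y then delta (nb K y W) else 0 := by
    rw [Finset.sum_filter, ← Finset.add_sum_erase W _ hv]
    simp
  have h2 : ∑ x ∈ W.erase v, beta (nb K x W) = ∑ x ∈ W.erase v, (beta (nb K x (W.erase v)) +
      if K.Adj v x then delta (nb K x W) else 0) := by
    refine Finset.sum_congr rfl fun x hx => ?_
    split_ifs with h
    · rw [← nb_erase_of_adj hv h, delta, Nat.add_sub_cancel]
      ring
    · rw [nb_erase_of_not_adj h, add_zero]
  rw [weight, weight, ← Finset.add_sum_erase W _ hv, h2, Finset.sum_add_distrib, ← h1]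
  ring

lemma weight_fill_le {W : Finset V} {x : V} (hx : x ∈ W) (hn : nb K x W ≤ 2) :
    weight (fill K W x) (W.erase x) ≤ weight K W := by
  refine le_trans (Finset.sum_le_sum fun u hu =>
    beta_mono (nb_fill_le hx hn (Finset.mem_of_mem_erase hu))) ?_
  exact Finset.sum_le_sum_of_subset_of_nonneg (Finset.erase_subset _ _)
    fun _ _ _ => beta_nonneg _

lemma weight_slack_fill_le {W : Finset V} {x : V} {d : ℕ} (h3 : 3 ≤ d) (h10 : d ≤ 10) (hx : x ∈ W)
    (hn : nb K x W ≤ 2) :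
    weight (fill K W x) (W.erase x) + slack (fill K W x) (W.erase x) d ≤
      weight K W + slack K W d := by
  by_cases hdef' : ∃ u ∈ W.erase x, 3 ≤ nb (fill K W x) u (W.erase x) ∧
      nb (fill K W x) u (W.erase x) < d
  · have := weight_fill_le hx hn
    have := slack_nonneg (K := K) (W := W) h3 h10
    rw [slack, if_pos hdef']
    linarith
  by_cases hdef : ∃ u ∈ W, 3 ≤ nb K u W ∧ nb K u W < d
  · rw [slack, if_neg hdef', slack, if_pos hdef]
    obtain ⟨u, hu, hu3, hud⟩ := hdef
    have hux : u ∈ W.erase x := Finset.mem_erase.2 ⟨by rintro rfl; omega, hu⟩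
    have hu2 : nb (fill K W x) u (W.erase x) ≤ 2 := by
      have h1 := nb_fill_le hx hn hu
      by_contra! h2
      exact hdef' ⟨u, hux, h2, by omega⟩
    have h1 : weight (fill K W x) (W.erase x) + 1 / 6 ≤ ∑ y ∈ W.erase x, beta (nb K y W) := by
      rw [weight, ← Finset.add_sum_erase _ _ hux, ← Finset.add_sum_erase _ _ hux, beta_eq_zero hu2]
      have h2 := le_beta hu3
      have h3 : ∑ y ∈ (W.erase x).erase u, beta (nb (fill K W x) y (W.erase x)) ≤
          ∑ y ∈ (W.erase x).erase u, beta (nb K y W) :=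
        Finset.sum_le_sum fun y hy => beta_mono
          (nb_fill_le hx hn (Finset.mem_of_mem_erase (Finset.mem_of_mem_erase hy)))
      linarith
    have h2 : ∑ y ∈ W.erase x, beta (nb K y W) ≤ weight K W :=
      Finset.sum_le_sum_of_subset_of_nonneg (Finset.erase_subset _ _) fun _ _ _ => beta_nonneg _
    have h3 := theta_le h3 h10
    linarith
  · rw [slack, if_neg hdef', slack, if_neg hdef]
    have := weight_fill_le hx hn
    linarith

lemma levelBound_three {N n : ℕ} (hN : 1 ≤ N) :
    LevelBound V n (1 / (3 * N)) (((N + 2) * (2 * improvingBound N) : ℕ) +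
      (8 + 3 * improvingBound N : ℕ) + (3 * (Nat.log 2 n + 1) : ℕ)) 3 := by
  intro K A W h hA hd
  induction hW : W.card using Nat.strong_induction_on generalizing K W with
  | _ m ih =>
    subst hW
    have hε : (0 : ℝ) ≤ 1 / (3 * N) := by positivity
    by_cases hx : ∃ x ∈ W, nb K x W ≤ 2
    · obtain ⟨x, hx, hn⟩ := hx
      have hlt := Finset.card_erase_lt_of_mem hx
      obtain ⟨k, h1, h2⟩ := ih _ hlt _ (W.erase x) (h.fill hx hn) (fun u hu =>
        (nb_fill_le hx hn (Finset.mem_of_mem_erase hu)).trans (hd u (Finset.mem_of_mem_erase hu)))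
        rfl
      refine ⟨k, h1.mono_graph fun u _ v _ huv => Or.inl huv, h2.trans ?_⟩
      have h3 := weight_slack_fill_le (d := 3) le_rfl (by norm_num) hx hn
      have h4 : (1 / (3 * N) : ℝ) * (W.erase x).card ≤ 1 / (3 * N) * W.card :=
        mul_le_mul_of_nonneg_left (by exact_mod_cast hlt.le) hε
      linarith
    · push Not at hx
      have hd3 : ∀ x ∈ W, nb K x W = 3 := fun x hxW => le_antisymm (hd x hxW) (hx x hxW)
      set I := improvingBound N with hI
      set M := (N + 2) * (W.card + 2 * I) with hM
      have hc : M ≤ 6 * N * (M / (6 * N) + 1) := (Nat.lt_mul_div_succ M (by omega)).le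
      have hw := h.hasWidth (hasWidth_cubic hN hd3 hc)
      refine ⟨_, hw, ?_⟩
      have hwt : weight K W = W.card * (1 / 6) := by
        rw [weight, Finset.sum_congr rfl fun x hx => by rw [hd3 x hx], Finset.sum_const,
          nsmul_eq_mul]
        rfl
      have hs : 0 ≤ slack K W 3 := slack_nonneg le_rfl (by norm_num)
      have hlog : ((3 * (Nat.log 2 A.card + 1) : ℕ) : ℝ) ≤ (3 * (Nat.log 2 n + 1) : ℕ) := by
        have : Nat.log 2 A.card ≤ Nat.log 2 n := Nat.log_mono_right hA
        exact_mod_cast (by omega)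
      have hN' : (1 : ℝ) ≤ N := by exact_mod_cast hN
      have hdiv : ((M / (6 * N) : ℕ) : ℝ) ≤ W.card * (1 / 6) + 1 / (3 * N) * W.card +
          ((N + 2) * (2 * I) : ℕ) := by
        refine (Nat.cast_div_le (m := M) (n := 6 * N)).trans ?_
        have e1 : ((N + 2 : ℝ) * (2 * I)) / (6 * N) ≤ (N + 2) * (2 * I) :=
          div_le_self (by positivity) (by linarith)
        have e2 : ((M : ℕ) : ℝ) / (6 * N : ℕ) = W.card * (1 / 6) + 1 / (3 * N) * W.card +
            ((N + 2 : ℝ) * (2 * I)) / (6 * N) := by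
          rw [hM]
          push_cast
          field_simp
          ring
        rw [e2]
        push_cast
        linarith
      rw [hwt]
      push_cast at hdiv hlog ⊢
      linarith

lemma levelBound_succ {n d : ℕ} {ε D : ℝ} (hε : 0 ≤ ε) (h3 : 3 ≤ d) (h9 : d ≤ 9)
    (hlev : LevelBound V n ε D d) : LevelBound V n ε (D + 1) (d + 1) := by
  intro K A W h hA hd
  have h3' : 3 ≤ d + 1 := by omega
  have h4' : 4 ≤ d + 1 := by omega
  have h10 : d + 1 ≤ 10 := by omega
  induction hm : A.card + W.card using Nat.strong_induction_on generalizing K A W with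
  | _ m ih =>
    subst hm
    have hmul : ∀ {W' : Finset V}, W' ⊆ W → ε * W'.card ≤ ε * W.card := fun hW =>
      mul_le_mul_of_nonneg_left (by exact_mod_cast Finset.card_le_card hW) hε
    by_cases hx : ∃ x ∈ W, nb K x W ≤ 2
    · obtain ⟨x, hx, hn⟩ := hx
      have hlt := Finset.card_erase_lt_of_mem hx
      obtain ⟨k, h1, h2⟩ := ih _ (by omega) _ A (W.erase x) (h.fill hx hn) hA (fun u hu =>
        (nb_fill_le hx hn (Finset.mem_of_mem_erase hu)).trans (hd u (Finset.mem_of_mem_erase hu)))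
        rfl
      refine ⟨k, h1.mono_graph fun u _ v _ huv => Or.inl huv, h2.trans ?_⟩
      have h5 := weight_slack_fill_le h3' h10 hx hn
      have h6 := hmul (Finset.erase_subset x W)
      linarith
    push Not at hx
    have hθ := theta_le h3' h10
    by_cases hsplit : ∃ U ⊆ W, U.Nonempty ∧ U ≠ W ∧ ∀ x ∈ U, ∀ y ∈ W \ U, ¬ K.Adj x y
    · obtain ⟨U, hUW, hUne, hUW', hno⟩ := hsplit
      have hU2 : (W \ U).Nonempty := by
        rw [Finset.sdiff_nonempty]
        exact fun h => hUW' (hUW.antisymm h)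
      obtain ⟨A₁, A₂, rfl, hdA, hnoA, e1, e2⟩ :=
        h.split (Finset.union_sdiff_of_subset hUW).symm Finset.disjoint_sdiff hno
      have c1 := Finset.card_union_of_disjoint hdA
      have c2 := Finset.card_sdiff_add_card_eq_card hUW
      have c3 := Finset.card_pos.2 hUne
      have c4 := Finset.card_pos.2 hU2
      have key : ∀ W' ⊆ W, (W \ W').Nonempty → (∀ x ∈ W', ∀ y ∈ W, K.Adj x y → y ∈ W') →
          weight K W' + slack K W' (d + 1) ≤ weight K W := by
        rintro W' hW' ⟨z, hz⟩ hcl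
        have f1 : weight K W' = ∑ x ∈ W', beta (nb K x W) := by
          refine Finset.sum_congr rfl fun x hx => ?_
          rw [le_antisymm (nb_mono K fun y hy _ => hW' hy) (nb_mono K (hcl x hx))]
        have f2 : ∑ x ∈ W', beta (nb K x W) + ∑ x ∈ W \ W', beta (nb K x W) = weight K W := by
          rw [add_comm, Finset.sum_sdiff hW', weight]
        have f3 : beta (nb K z W) ≤ ∑ x ∈ W \ W', beta (nb K x W) :=
          Finset.single_le_sum (f := fun x => beta (nb K x W)) (fun _ _ => beta_nonneg _) hz
        have f4 := le_beta (hx z (Finset.mem_sdiff.1 hz).1)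
        have f5 := slack_le (K := K) (W := W') h3' h10
        linarith
      have hcl1 : ∀ x ∈ U, ∀ y ∈ W, K.Adj x y → y ∈ U := by
        intro x hx y hy hxy
        by_contra hyU
        exact hno x hx y (Finset.mem_sdiff.2 ⟨hy, hyU⟩) hxy
      have hcl2 : ∀ x ∈ W \ U, ∀ y ∈ W, K.Adj x y → y ∈ W \ U := by
        intro x hx y hy hxy
        exact Finset.mem_sdiff.2 ⟨hy, fun hyU => hno y hyU x hx hxy.symm⟩
      obtain ⟨k₁, w1, b1⟩ := ih _ (by omega) K A₁ U e1 (by omega)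
        (fun x hx => (nb_mono K fun y hy _ => hUW hy).trans (hd x (hUW hx))) rfl
      obtain ⟨k₂, w2, b2⟩ := ih _ (by omega) K A₂ (W \ U) e2 (by omega)
        (fun x hx => (nb_mono K fun y hy _ => Finset.sdiff_subset hy).trans
          (hd x (Finset.sdiff_subset hx))) rfl
      refine ⟨max k₁ k₂, (w1.mono (le_max_left _ _)).union (w2.mono (le_max_right _ _)) hdA hnoA,
        ?_⟩
      have g1 := key U hUW hU2 hcl1
      have g2 := key (W \ U) Finset.sdiff_subset
        (by rwa [Finset.sdiff_sdiff_eq_self hUW]) hcl2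
      have g3 := hmul hUW
      have g4 := hmul (W' := W \ U) Finset.sdiff_subset
      have g5 := slack_nonneg (K := K) (W := W) h3' h10
      push_cast
      refine max_le ?_ ?_ <;> linarith
    push Not at hsplit
    by_cases hex : ∃ x ∈ W, nb K x W = d + 1
    swap
    · push Not at hex
      obtain ⟨k, h1, h2⟩ := hlev K A W h hA fun x hxW =>
        Nat.le_of_lt_succ (lt_of_le_of_ne (hd x hxW) (hex x hxW))
      refine ⟨k, h1, h2.trans ?_⟩
      have f1 := slack_le (K := K) (W := W) h3 (by omega)
      have f2 := theta_le h3 (by omega)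
      have f3 := slack_nonneg (K := K) (W := W) h3' h10
      linarith
    have hdel : ∀ v ∈ W, weight K (W.erase v) + slack K (W.erase v) (d + 1) + 1 ≤
        weight K W + slack K W (d + 1) → ∃ k : ℕ, HasWidth K A k ∧
          (k : ℝ) ≤ weight K W + slack K W (d + 1) + ε * W.card + (D + 1) := by
      intro v hv hle
      have c1 := Finset.card_erase_lt_of_mem hv
      have c2 := Finset.card_le_card (Finset.erase_subset v A)
      obtain ⟨k, h1, h2⟩ := ih _ (by omega) K (A.erase v) (W.erase v) (h.erase v) (c2.trans hA)
        (fun x hx => (nb_mono K fun y hy _ => Finset.mem_of_mem_erase hy).trans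
          (hd x (Finset.mem_of_mem_erase hx))) rfl
      refine ⟨k + 1, h1.of_erase, ?_⟩
      have f1 := hmul (Finset.erase_subset v W)
      push_cast
      linarith
    obtain ⟨z, hz, hzd⟩ := hex
    by_cases hdef : ∃ x ∈ W, 3 ≤ nb K x W ∧ nb K x W < d + 1
    · obtain ⟨y, hy, -, hyd⟩ := id hdef
      obtain ⟨v, hv, u, hu, hvu⟩ := hsplit (W.filter fun x => nb K x W = d + 1)
        (Finset.filter_subset _ _) ⟨z, Finset.mem_filter.2 ⟨hz, hzd⟩⟩ (fun h => by
          have := Finset.filter_eq_self.1 h y hy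
          omega)
      obtain ⟨hv, hvd⟩ := Finset.mem_filter.1 hv
      have huW := (Finset.mem_sdiff.1 hu).1
      have hud : nb K u W ≤ d := by
        have h1 := hd u huW
        have h2 : nb K u W ≠ d + 1 := fun h =>
          (Finset.mem_sdiff.1 hu).2 (Finset.mem_filter.2 ⟨huW, h⟩)
        omega
      refine hdel v hv ?_
      have hwe := weight_erase (K := K) hv
      have hNcard : (W.filter fun y => K.Adj v y).card = d + 1 := hvd
      have huN : u ∈ W.filter fun y => K.Adj v y := Finset.mem_filter.2 ⟨huW, hvu⟩
      rw [show slack K W (d + 1) = 0 from if_pos hdef]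
      by_cases hdef' : ∃ x ∈ W.erase v, 3 ≤ nb K x (W.erase v) ∧ nb K x (W.erase v) < d + 1
      · rw [show slack K (W.erase v) (d + 1) = 0 from if_pos hdef']
        rw [← Finset.add_sum_erase _ _ huN] at hwe
        have f1 := delta_anti (hx u huW) hud (by omega)
        have f2 : (d : ℝ) * delta (d + 1) ≤
            ∑ y ∈ (W.filter fun y => K.Adj v y).erase u, delta (nb K y W) := by
          have := Finset.card_nsmul_le_sum ((W.filter fun y => K.Adj v y).erase u)
            (fun y => delta (nb K y W)) (delta (d + 1)) fun y hy => by
              have hyW := (Finset.mem_filter.1 (Finset.mem_of_mem_erase hy)).1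
              exact delta_anti (hx y hyW) (hd y hyW) h10
          rwa [Finset.card_erase_of_mem huN, hNcard, nsmul_eq_mul, Nat.add_sub_cancel] at this
        have f3 := gain_of_deficient h4' h10
        rw [Nat.add_sub_cancel] at f3
        rw [hvd] at hwe
        linarith
      · rw [show slack K (W.erase v) (d + 1) = theta (d + 1) from if_neg hdef']
        have f1 : ∑ y ∈ W with K.Adj v y, delta (nb K y W) = (d + 1 : ℕ) * delta 3 := by
          rw [Finset.sum_congr rfl fun y hy => ?_, Finset.sum_const, hNcard, nsmul_eq_mul]
          obtain ⟨hyW, hvy⟩ := Finset.mem_filter.1 hy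
          have g1 := nb_erase_of_adj hv hvy
          have g2 := hd y hyW
          have g3 := hx y hyW
          have g4 : ¬ 3 ≤ nb K y (W.erase v) := fun h3 =>
            hdef' ⟨y, Finset.mem_erase.2 ⟨hvy.ne', hyW⟩, h3, by omega⟩
          rw [show nb K y W = 3 by omega]
        have f2 := gain_of_cubic_nbrs h4' h10
        rw [hvd, f1] at hwe
        linarith
    · have hreg : ∀ x ∈ W, nb K x W = d + 1 := by
        intro x hxW
        by_contra hne
        exact hdef ⟨x, hxW, hx x hxW, lt_of_le_of_ne (hd x hxW) hne⟩
      refine hdel z hz ?_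
      have hwe := weight_erase (K := K) hz
      have hNcard : (W.filter fun y => K.Adj z y).card = d + 1 := hzd
      have f1 : ∑ y ∈ W with K.Adj z y, delta (nb K y W) = (d + 1 : ℕ) * delta (d + 1) := by
        rw [Finset.sum_congr rfl fun y hy => by rw [hreg y (Finset.mem_filter.1 hy).1],
          Finset.sum_const, hNcard, nsmul_eq_mul]
      have hdef' : ∃ x ∈ W.erase z, 3 ≤ nb K x (W.erase z) ∧ nb K x (W.erase z) < d + 1 := by
        obtain ⟨y, hyW, hzy⟩ := (nb_pos K).1 (show 0 < nb K z W by omega)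
        have g1 := nb_erase_of_adj hz hzy
        have g2 := hreg y hyW
        exact ⟨y, Finset.mem_erase.2 ⟨hzy.ne', hyW⟩, by omega, by omega⟩
      rw [show slack K (W.erase z) (d + 1) = 0 from if_pos hdef',
        show slack K W (d + 1) = theta (d + 1) from if_neg hdef]
      have f2 := gain_of_regular h4' h10
      rw [hzd, f1] at hwe
      linarith

end levels

section multigraph

variable {E : Type} [Fintype V] [Fintype E]

/-- The simple graph underlying a multigraph. -/
def underlying (ends : E → Sym2 V) : SimpleGraph V where
  Adj u v := u ≠ v ∧ ∃ e, ends e = s(u, v)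
  symm := ⟨fun _ _ h => ⟨h.1.symm, h.2.imp fun _ he => he.trans Sym2.eq_swap⟩⟩
  loopless := ⟨fun _ h => h.1 rfl⟩

lemma pathwidth_le {ends : E → Sym2 V} {k : ℕ}
    (h : HasWidth (underlying ends) Finset.univ k) : Multigraph.pathwidth ends ≤ k := by
  obtain ⟨l, r, h1, h2, h3⟩ := h
  have hr : ∀ v, r v ≤ Finset.univ.sup r := fun v => Finset.le_sup (Finset.mem_univ v)
  have h1' : ∀ v, l v ≤ r v := fun v => h1 v (Finset.mem_univ v)
  have h2' : ∀ u v, (underlying ends).Adj u v → l u ≤ r v := fun u v =>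
    h2 u (Finset.mem_univ u) v (Finset.mem_univ v)
  refine Nat.sInf_le ⟨Finset.univ.sup r,
    fun t => Finset.univ.filter fun v => l v ≤ t ∧ (t : ℕ) ≤ r v, ⟨?_, ?_, ?_⟩,
    fun t => (h3 t).trans (Nat.le_succ k)⟩
  · intro v
    exact ⟨⟨l v, by have := h1' v; have := hr v; omega⟩, by simpa using h1' v⟩
  · intro v a b c hab hbc ha hc
    simp only [Finset.mem_filter, Finset.mem_univ, true_and] at ha hc ⊢
    exact ⟨ha.1.trans hab, le_trans hbc hc.2⟩
  · intro e
    obtain ⟨⟨a, b⟩, hab⟩ := (ends e).exists_rep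
    have hab : ends e = s(a, b) := hab.symm
    have hl : l a ≤ r b ∧ l b ≤ r a := by
      by_cases h : a = b
      · subst h
        exact ⟨h1' a, h1' a⟩
      · have hadj : (underlying ends).Adj a b := ⟨h, e, hab⟩
        exact ⟨h2' a b hadj, h2' b a hadj.symm⟩
    have ha := h1' a
    have hb := h1' b
    have hra := hr a
    refine ⟨⟨max (l a) (l b), by omega⟩, fun u hu => ?_⟩
    rw [hab, Sym2.mem_iff] at hu
    simp only [Finset.mem_filter, Finset.mem_univ, true_and]
    rcases hu with rfl | rfl <;> omega

lemma one_le_count_toMul {z : Sym2 V} {v : V} (h : v ∈ z) : 1 ≤ Multiset.count v z.toMul := by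
  induction z with
  | _ a b =>
    rw [Multiset.one_le_count_iff_mem]
    rcases Sym2.mem_iff.1 h with rfl | rfl <;> simp [Sym2.toMul]

lemma nb_underlying_le (ends : E → Sym2 V) (v : V) (S : Finset V) :
    nb (underlying ends) v S ≤ Multigraph.deg ends v := by
  have h1 : (S.filter fun y => (underlying ends).Adj v y) ⊆
      (Finset.univ.filter fun e => v ∈ ends e).image fun e =>
        if h : v ∈ ends e then Sym2.Mem.other h else v := by
    intro y hy
    obtain ⟨-, hne, e, he⟩ := Finset.mem_filter.1 hy
    have hv : v ∈ ends e := by simp [he]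
    refine Finset.mem_image.2 ⟨e, by simp [hv], ?_⟩
    rw [dif_pos hv]
    have := Sym2.other_spec hv
    exact Sym2.congr_right.1 (this.trans he)
  refine (Finset.card_le_card h1).trans (Finset.card_image_le.trans ?_)
  rw [Finset.card_filter]
  refine Finset.sum_le_sum fun e _ => ?_
  split_ifs with h
  · exact one_le_count_toMul h
  · exact Nat.zero_le _

lemma sum_beta_deg (ends : E → Sym2 V) :
    ∑ v, beta (Multigraph.deg ends v) =
      (1 / 6) * (Multigraph.numDeg ends 3 : ℝ)
      + (1 / 3) * (Multigraph.numDeg ends 4 : ℝ)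
      + (13 / 30) * (Multigraph.numDeg ends 5 : ℝ)
      + (23 / 45) * (Multigraph.numDeg ends 6 : ℝ)
      + (359 / 630) * (Multigraph.numDeg ends 7 : ℝ)
      + (1553 / 2520) * (Multigraph.numDeg ends 8 : ℝ)
      + (14827 / 22680) * (Multigraph.numDeg ends 9 : ℝ)
      + (155273 / 226800) * (Multigraph.numDeg ends 10 : ℝ)
      + (Multigraph.numDegGE ends 11 : ℝ) := by
  have hc : ∀ p : V → Prop, ∀ _ : DecidablePred p,
      ((Finset.univ.filter p).card : ℝ) = ∑ v, if p v then (1 : ℝ) else 0 := by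
    intro p _
    simp
  simp only [Multigraph.numDeg, Multigraph.numDegGE, hc, Finset.mul_sum,
    ← Finset.sum_add_distrib]
  refine Finset.sum_congr rfl fun v _ => ?_
  generalize Multigraph.deg ends v = d
  by_cases h : d < 11
  · interval_cases d <;> norm_num [beta]
  · obtain ⟨m, rfl⟩ : ∃ m, d = m + 11 := ⟨d - 11, by omega⟩
    simp [beta]

lemma levelBound_ten {V : Type} [DecidableEq V] {n N : ℕ} (hN : 1 ≤ N) :
    LevelBound V n (1 / (3 * N)) (((N + 2) * (2 * improvingBound N) : ℕ) +
      (8 + 3 * improvingBound N : ℕ) + (3 * (Nat.log 2 n + 1) : ℕ) + 1 + 1 + 1 + 1 + 1 + 1 + 1)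
      10 := by
  have hε : (0 : ℝ) ≤ 1 / (3 * N) := by positivity
  refine levelBound_succ hε (by norm_num) (by norm_num) ?_
  refine levelBound_succ hε (by norm_num) (by norm_num) ?_
  refine levelBound_succ hε (by norm_num) (by norm_num) ?_
  refine levelBound_succ hε (by norm_num) (by norm_num) ?_
  refine levelBound_succ hε (by norm_num) (by norm_num) ?_
  refine levelBound_succ hε (by norm_num) (by norm_num) ?_
  exact levelBound_succ hε (by norm_num) (by norm_num) (levelBound_three hN)

lemma eventually_log_le {ε : ℝ} (hε : 0 < ε) (C : ℝ) :
    ∃ n₀ : ℕ, ∀ n : ℕ, n₀ < n → C + 3 * (Nat.log 2 n : ℝ) ≤ ε * n := by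
  have h2 : (0 : ℝ) < Real.log 2 := Real.log_pos one_lt_two
  have h1 := (Real.isLittleO_log_id_atTop.def (c := ε * Real.log 2 / 6) (by positivity))
  have h3 := (tendsto_natCast_atTop_atTop (R := ℝ)).eventually h1
  have h4 := (tendsto_natCast_atTop_atTop (R := ℝ)).eventually_ge_atTop (2 * C / ε)
  obtain ⟨n₀, hn₀⟩ := Filter.eventually_atTop.1 (h3.and h4)
  refine ⟨n₀, fun n hn => ?_⟩
  obtain ⟨h5, h6⟩ := hn₀ n hn.le
  have h7 : (Nat.log 2 n : ℝ) ≤ Real.log n / Real.log 2 := Real.natLog_le_logb n 2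
  simp only [id, Real.norm_eq_abs, Nat.abs_cast] at h5
  have h8 : Real.log n / Real.log 2 ≤ ε / 6 * n := by
    rw [div_le_iff₀ h2]
    calc Real.log n ≤ |Real.log n| := le_abs_self _
      _ ≤ _ := h5
      _ = _ := by ring
  rw [div_le_iff₀ hε] at h6
  linarith

lemma pathwidth_le_sum {N : ℕ} (hN : 1 ≤ N) (ends : E → Sym2 V) :
    (Multigraph.pathwidth ends : ℝ) ≤ ∑ v, beta (Multigraph.deg ends v) +
      1 / (3 * N) * Fintype.card V + (((N + 2) * (2 * improvingBound N) : ℕ) +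
      (8 + 3 * improvingBound N : ℕ) + 11 + 3 * (Nat.log 2 (Fintype.card V) : ℝ)) := by
  set G := underlying ends with hG
  set R := Finset.univ.filter fun v => 11 ≤ Multigraph.deg ends v with hR
  have hdeg : ∀ v ∈ Finset.univ \ R, Multigraph.deg ends v ≤ 10 := by
    intro v hv
    simp only [hR, Finset.mem_sdiff, Finset.mem_univ, Finset.mem_filter, true_and] at hv
    omega
  obtain ⟨k, hk, hkle⟩ := levelBound_ten (n := Fintype.card V) hN G (Finset.univ \ R)
    (Finset.univ \ R) .base (Finset.card_le_univ _)
    fun v hv => (nb_underlying_le ends v _).trans (hdeg v hv)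
  have hpw : (Multigraph.pathwidth ends : ℝ) ≤ k + R.card := by
    exact_mod_cast pathwidth_le hk.of_sdiff
  have hw : weight G (Finset.univ \ R) ≤ ∑ v ∈ Finset.univ \ R, beta (Multigraph.deg ends v) :=
    Finset.sum_le_sum fun v _ => beta_mono (nb_underlying_le ends v _)
  have hRsum : (R.card : ℝ) = ∑ v ∈ R, beta (Multigraph.deg ends v) := by
    rw [Finset.card_eq_sum_ones, Nat.cast_sum]
    refine Finset.sum_congr rfl fun v hv => ?_
    obtain ⟨m, hm⟩ : ∃ m, Multigraph.deg ends v = m + 11 :=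
      ⟨_ - 11, (Nat.sub_add_cancel (Finset.mem_filter.1 hv).2).symm⟩
    simp [hm, beta]
  have hsum := Finset.sum_sdiff (f := fun v => beta (Multigraph.deg ends v)) (Finset.subset_univ R)
  have hs := (slack_le (K := G) (W := Finset.univ \ R) (d := 10) (by norm_num) le_rfl).trans
    (theta_le (by norm_num) le_rfl)
  have hcard : (1 / (3 * N) : ℝ) * (Finset.univ \ R).card ≤ 1 / (3 * N) * Fintype.card V :=
    mul_le_mul_of_nonneg_left (by exact_mod_cast Finset.card_le_univ _) (by positivity)
  push_cast at hkle ⊢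
  linarith

end multigraph

end PathwidthBound

/-- For every `ε > 0` there is `n_ε` such that every multigraph on `n > n_ε` vertices has
pathwidth at most
`(1/6)n₃ + (1/3)n₄ + (13/30)n₅ + (23/45)n₆ + (359/630)n₇ + (1553/2520)n₈
  + (14827/22680)n₉ + (155273/226800)n₁₀ + n_{≥11} + εn`,
where `n_i` is the number of vertices of degree `i` and `n_{≥11}` the number of vertices of
degree at least `11`. -/
theorem pathwidth_multigraph_degree_bound :
    ∀ ε : ℝ, 0 < ε → ∃ nε : ℕ,
      ∀ (V E : Type) [Fintype V] [DecidableEq V] [Fintype E] (ends : E → Sym2 V),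
        nε < Fintype.card V →
        (Multigraph.pathwidth ends : ℝ) ≤
          (1 / 6) * (Multigraph.numDeg ends 3 : ℝ)
          + (1 / 3) * (Multigraph.numDeg ends 4 : ℝ)
          + (13 / 30) * (Multigraph.numDeg ends 5 : ℝ)
          + (23 / 45) * (Multigraph.numDeg ends 6 : ℝ)
          + (359 / 630) * (Multigraph.numDeg ends 7 : ℝ)
          + (1553 / 2520) * (Multigraph.numDeg ends 8 : ℝ)
          + (14827 / 22680) * (Multigraph.numDeg ends 9 : ℝ)
          + (155273 / 226800) * (Multigraph.numDeg ends 10 : ℝ)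
          + (Multigraph.numDegGE ends 11 : ℝ)
          + ε * (Fintype.card V : ℝ) := by
  intro ε hε
  obtain ⟨N, hN⟩ := exists_nat_gt (1 / ε)
  have hN0 : (0 : ℝ) < N := (by positivity : (0 : ℝ) < 1 / ε).trans hN
  have hN1 : 1 ≤ N := by exact_mod_cast hN0
  obtain ⟨n₀, hn₀⟩ := PathwidthBound.eventually_log_le (ε := ε / 2) (by positivity)
    (((N + 2) * (2 * PathwidthBound.improvingBound N) : ℕ) +
      (8 + 3 * PathwidthBound.improvingBound N : ℕ) + 11)
  refine ⟨n₀, fun V E _ _ _ ends hn => ?_⟩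
  have h1 := PathwidthBound.pathwidth_le_sum hN1 ends
  have h2 := hn₀ _ hn
  have h3 : (1 / (3 * N) : ℝ) * Fintype.card V ≤ ε / 2 * Fintype.card V := by
    refine mul_le_mul_of_nonneg_right ?_ (Nat.cast_nonneg _)
    rw [div_lt_iff₀ hε] at hN
    rw [div_le_iff₀ (by positivity)]
    linarith
  rw [PathwidthBound.sum_beta_deg] at h1
  linarith
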